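/- arXiv:1809.06829 — 4 statements merged into one kernel-verified Lean document; each statement's English description precedes it below -/
import Mathlib

section
/- Let f : A → ℓ^∞ be a Lipschitz map defined on a measurable set A ⊂ ℝ^k, and suppose that the rank of the component-wise approximate derivative ap Df(x) is at least j on a subset of A of positive Lebesgue measure. Then there exist an open set U ⊂ ℝ^k, a set K ⊂ A ∩ U of positive Lebesgue measure, a bi-Lipschitz C¹-diffeomorphism G : U → G(U) ⊂ ℝ^k, and a permutation Ψ : ℓ^∞ → ℓ^∞ of finitely many coordinates (an isometry of ℓ^∞), such that (Ψ∘f∘G⁻¹)_i(x) = x_i for i = 1,…,j and all x ∈ G(K). -/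
open MeasureTheory Metric Set Filter
open scoped ENNReal NNReal Topology

noncomputable section

abbrev EucSp (k : ℕ) := EuclideanSpace ℝ (Fin k)

/-- The volume of the unit ball in `ℝ^n`. -/
def unitBallVol (n : ℕ) : ℝ≥0∞ := volume (Metric.ball (0 : EucSp n) 1)

/-- The `n`-dimensional Hausdorff content. -/
def hContent {X : Type*} [PseudoEMetricSpace X] (n : ℕ) (E : Set X) : ℝ≥0∞ :=
  ⨅ (A : ℕ → Set X) (_ : E ⊆ ⋃ i, A i),
    unitBallVol n / 2 ^ n * ∑' i, EMetric.diam (A i) ^ n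

/-- Upper n-density. -/
def upperDensity {k : ℕ} {X : Type*} [PseudoEMetricSpace X] (n : ℕ)
    (f : EucSp k → X) (A : Set (EucSp k)) (x : EucSp k) : ℝ≥0∞ :=
  Filter.limsup
    (fun r : ℝ => hContent n (f '' (Metric.ball x r ∩ A)) /
      (unitBallVol n * ENNReal.ofReal r ^ n)) (𝓝[>] (0:ℝ))

def lowerDensity {k : ℕ} {X : Type*} [PseudoEMetricSpace X] (n : ℕ)
    (f : EucSp k → X) (A : Set (EucSp k)) (x : EucSp k) : ℝ≥0∞ :=
  Filter.liminf
    (fun r : ℝ => hContent n (f '' (Metric.ball x r ∩ A)) /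
      (unitBallVol n * ENNReal.ofReal r ^ n)) (𝓝[>] (0:ℝ))

def IsDensityPoint {k : ℕ} (E : Set (EucSp k)) (x : EucSp k) : Prop :=
  Filter.Tendsto (fun r : ℝ => volume (E ∩ Metric.ball x r) / volume (Metric.ball x r))
    (𝓝[>] (0:ℝ)) (𝓝 1)

def HasApproxDerivWithinAt {k : ℕ} (A : Set (EucSp k)) (f : EucSp k → ℝ)
    (L : EucSp k →ₗ[ℝ] ℝ) (x : EucSp k) : Prop :=
  ∃ Ax : Set (EucSp k), Ax ⊆ A ∧ MeasurableSet Ax ∧ IsDensityPoint Ax x ∧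
    Filter.Tendsto (fun y => |f y - f x - L (y - x)| / ‖y - x‖) (𝓝[Ax] x) (𝓝 0)

abbrev LpInfty := lp (fun _ : ℕ => ℝ) ∞

def HasCompApproxDerivWithinAt {k : ℕ} (A : Set (EucSp k)) (f : EucSp k → LpInfty)
    (D : EucSp k →ₗ[ℝ] (ℕ → ℝ)) (x : EucSp k) : Prop :=
  ∀ i : ℕ, HasApproxDerivWithinAt A (fun y => f y i) ((LinearMap.proj i).comp D) x

def IsBiLipC1DiffeoOn {k : ℕ} (G Ginv : EucSp k → EucSp k) (U : Set (EucSp k)) : Prop :=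
  IsOpen U ∧ IsOpen (G '' U) ∧ (∀ x ∈ U, Ginv (G x) = x) ∧ (∀ y ∈ G '' U, G (Ginv y) = y) ∧
    ContDiffOn ℝ 1 G U ∧ ContDiffOn ℝ 1 Ginv (G '' U) ∧
    ∃ Λ : ℝ≥0, LipschitzOnWith Λ G U ∧ LipschitzOnWith Λ Ginv (G '' U)

def IsFinCoordPerm (Ψ : LpInfty → LpInfty) : Prop :=
  ∃ σ : Equiv.Perm ℕ, {i | σ i ≠ i}.Finite ∧ ∀ (x : LpInfty) (i : ℕ), Ψ x i = x (σ i)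

def openCube {k : ℕ} (c : EucSp k) (d : ℝ) : Set (EucSp k) := {x | ∀ i, |x i - c i| < d / 2}

def closedCube {k : ℕ} (c : EucSp k) (d : ℝ) : Set (EucSp k) := {x | ∀ i, |x i - c i| ≤ d / 2}

def hnmContent {N : ℕ} {X : Type*} [PseudoEMetricSpace X] (n m : ℕ)
    (f : EucSp N → X) (Q : Set (EucSp N)) : ℝ≥0∞ :=
  ⨅ (c : ℕ → EucSp N) (d : ℕ → ℝ) (_ : ∀ j, 0 ≤ d j) (_ : ∀ j, openCube (c j) (d j) ⊆ Q)
    (_ : Pairwise (Function.onFun Disjoint fun j => openCube (c j) (d j)))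
    (_ : volume (Q \ ⋃ j, openCube (c j) (d j)) = 0),
    ∑' j, hContent n (f '' openCube (c j) (d j)) * ENNReal.ofReal (d j) ^ m

def matrixRow {n k : ℕ} (D : Matrix (Fin n) (Fin k) ℝ) (i : Fin n) : EucSp k →ₗ[ℝ] ℝ :=
  (EuclideanSpace.proj i).toLinearMap.comp (Matrix.toEuclideanLin D)

def jacDet {n k : ℕ} (D : Matrix (Fin n) (Fin k) ℝ) : ℝ := Real.sqrt ((D * D.transpose).det)

def upperLintegral {Y : Type*} [MeasurableSpace Y] (μ : Measure Y) (g : Y → ℝ≥0∞) : ℝ≥0∞ :=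
  ⨅ (h : Y → ℝ≥0∞) (_ : Measurable h) (_ : ∀ y, g y ≤ h y), ∫⁻ y, h y ∂μ


open scoped Pointwise in
lemma uniqueDiff_of_density {k : ℕ} {s : Set (EucSp k)} {x : EucSp k}
    (h : Tendsto (fun r : ℝ => volume (s ∩ closedBall x r) / volume (closedBall x r))
      (𝓝[>] 0) (𝓝 1)) : UniqueDiffWithinAt ℝ s x := by
  have key : ∀ (z : EucSp k) (n : ℕ), ∃ (r : ℝ) (a : EucSp k), 0 < r ∧ r < 1 / ((n:ℝ) + 1) ∧
      ‖a - z‖ ≤ 1 / ((n:ℝ) + 1) ∧ x + r • a ∈ s := by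
    intro z n
    have εpos : (0:ℝ) < 1 / ((n:ℝ) + 1) := by positivity
    have B₁ : ∀ᶠ r in 𝓝[>] (0 : ℝ),
        (s ∩ ({x} + r • closedBall z (1 / ((n:ℝ) + 1)))).Nonempty :=
      Measure.eventually_nonempty_inter_smul_of_density_one volume s x h _ measurableSet_closedBall
        (measure_closedBall_pos volume z εpos).ne'
    obtain ⟨r, ⟨y, ys, hy⟩, hr⟩ := (B₁.and (Ioo_mem_nhdsGT εpos)).exists
    simp only [mem_smul_set, image_add_left, mem_preimage, singleton_add] at hy
    rcases hy with ⟨a, az, ha⟩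
    refine ⟨r, a, hr.1, hr.2, mem_closedBall_iff_norm.1 az, ?_⟩
    have : x + r • a = y := by rw [ha]; simp
    rwa [this]
  have l0 : Tendsto (fun n : ℕ => 1 / ((n:ℝ) + 1)) atTop (𝓝 0) :=
    tendsto_one_div_add_atTop_nhds_zero_nat
  have all : ∀ z, z ∈ tangentConeAt ℝ s x := by
    intro z
    choose r a h1 h2 h3 h4 using key z
    have ta : Tendsto a atTop (𝓝 z) := by
      rw [tendsto_iff_norm_sub_tendsto_zero]
      exact squeeze_zero (fun _ => norm_nonneg _) h3 l0
    have tr : Tendsto r atTop (𝓝 0) :=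
      squeeze_zero (fun n => (h1 n).le) (fun n => (h2 n).le) l0
    refine mem_tangentConeAt_of_seq atTop (fun n => (r n)⁻¹) (fun n => r n • a n) ?_ ?_ ?_
    · simpa using tr.smul ta
    · exact Eventually.of_forall h4
    · refine ta.congr fun n => ?_
      rw [smul_smul, inv_mul_cancel₀ (h1 n).ne', one_smul]
  constructor
  · have : tangentConeAt ℝ s x = univ := eq_univ_of_forall all
    rw [this]; simp
  · exact zero_mem_tangentConeAt_iff.1 (all 0)

lemma uniqueDiff_of_isDensityPoint {k : ℕ} {s : Set (EucSp k)} {x : EucSp k}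
    (h : IsDensityPoint s x) : UniqueDiffWithinAt ℝ s x := by
  apply uniqueDiff_of_density
  refine h.congr' ?_
  filter_upwards [self_mem_nhdsWithin] with r hr
  have hs : volume (sphere x r) = 0 := Measure.addHaar_sphere_of_ne_zero _ _ (ne_of_gt hr)
  have h1 : (ball x r : Set (EucSp k)) =ᵐ[volume] closedBall x r := by
    rw [← ball_union_sphere]
    exact (union_ae_eq_left_of_ae_eq_empty (ae_eq_empty.2 hs)).symm
  rw [measure_congr h1, measure_congr (Filter.EventuallyEq.inter (ae_eq_refl s) h1)]

lemma exists_perm (n : ℕ) (s : ℕ → ℕ) (hs : Set.InjOn s (Iio n)) :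
    ∃ t : Equiv.Perm ℕ, {i | t i ≠ i}.Finite ∧ ∀ i < n, t i = s i := by
  induction n with
  | zero => exact ⟨1, by simp, by simp⟩
  | succ n ih =>
    obtain ⟨t, ht, h⟩ := ih (hs.mono (fun i (hi : i < n) => Nat.lt_succ_of_lt hi))
    refine ⟨Equiv.swap (t n) (s n) * t, ?_, ?_⟩
    · refine (ht.union (Set.toFinite {n, t⁻¹ (s n)})).subset ?_
      intro i hi
      by_contra hc
      simp only [mem_union, mem_ofPred_eq, mem_insert_iff, mem_singleton_iff, not_or, not_not] at hc
      apply hi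
      have h1 : t i ≠ t n := fun h => hc.2.1 (t.injective h)
      have h2 : t i ≠ s n := fun h => hc.2.2 (by rw [← h]; simp)
      rw [Equiv.Perm.mul_apply, Equiv.swap_apply_of_ne_of_ne h1 h2, hc.1]
    · intro i hi
      rcases Nat.lt_succ_iff_lt_or_eq.1 hi with hi' | rfl
      · have h1 : t i ≠ t n := fun h => hi'.ne (t.injective h)
        have h2 : t i ≠ s n := by
          rw [h i hi']
          intro h'
          exact hi'.ne (hs (show i < n + 1 from hi) (show n < n + 1 by omega) h')
        rw [Equiv.Perm.mul_apply, Equiv.swap_apply_of_ne_of_ne h1 h2, h i hi']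
      · simp

lemma exists_rows {k j : ℕ} (D : EucSp k →ₗ[ℝ] (ℕ → ℝ)) (h : (j : Cardinal) ≤ LinearMap.rank D) :
    ∃ s : Fin j → ℕ, Function.Injective s ∧
      LinearIndependent ℝ (fun i => (LinearMap.proj (s i)).comp D : Fin j → (EucSp k →ₗ[ℝ] ℝ)) := by
  set v : ℕ → Module.Dual ℝ (EucSp k) := fun i => (LinearMap.proj i).comp D with hv
  obtain ⟨κ, a, ha, hsp, hli⟩ := exists_linearIndependent' ℝ v
  have : Finite κ := hli.finite
  have := Fintype.ofFinite κ
  have hker : (Submodule.span ℝ (range v)).dualCoannihilator = LinearMap.ker D := by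
    ext x
    simp only [Submodule.mem_dualCoannihilator, LinearMap.mem_ker]
    constructor
    · intro hx
      ext i
      exact hx (v i) (Submodule.subset_span ⟨i, rfl⟩)
    · intro hx φ hφ
      induction hφ using Submodule.span_induction with
      | mem y hy => obtain ⟨i, rfl⟩ := hy; simp [hv, hx]
      | zero => simp
      | add _ _ _ _ h1 h2 => simp [h1, h2]
      | smul _ _ _ h1 => simp [h1]
  have h1 := Subspace.finrank_add_finrank_dualCoannihilator_eq (Submodule.span ℝ (range v))
  have h2 := LinearMap.finrank_range_add_finrank_ker D
  have h3 : Module.finrank ℝ (Submodule.span ℝ (range v)) = Fintype.card κ := by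
    rw [← hsp]; exact finrank_span_eq_card hli
  have h4 : j ≤ Module.finrank ℝ (LinearMap.range D) := by
    rw [LinearMap.rank, ← Module.finrank_eq_rank] at h
    exact_mod_cast h
  rw [hker] at h1
  have h5 : j ≤ Fintype.card κ := by omega
  let e : Fin j → κ := fun i => (Fintype.equivFin κ).symm (Fin.castLE h5 i)
  have he : Function.Injective e := (Fintype.equivFin κ).symm.injective.comp (Fin.castLE_injective h5)
  exact ⟨a ∘ e, ha.comp he, hli.comp e he⟩

lemma exists_extend {j m : ℕ} (w : Fin j → Module.Dual ℝ (EucSp (j + m)))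
    (hw : LinearIndependent ℝ w) :
    ∃ b : Fin m → Module.Dual ℝ (EucSp (j + m)), ∀ x : EucSp (j + m),
      (∀ i, w i x = 0) → (∀ i, b i x = 0) → x = 0 := by
  let B := Module.Basis.sumExtend hw
  have : Finite (Fin j ⊕ Module.Basis.sumExtendIndex hw) := Module.Finite.finite_basis B
  have : Finite (Module.Basis.sumExtendIndex hw) :=
    Finite.of_injective (Sum.inr : _ → Fin j ⊕ Module.Basis.sumExtendIndex hw) Sum.inr_injective
  have := Fintype.ofFinite (Module.Basis.sumExtendIndex hw)
  have hc := Module.finrank_eq_card_basis B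
  have hc' : Fintype.card (Module.Basis.sumExtendIndex hw) = m := by
    rw [Subspace.dual_finrank_eq] at hc
    rw [finrank_euclideanSpace_fin, Fintype.card_sum, Fintype.card_fin] at hc
    omega
  let e := Fintype.equivFinOfCardEq hc'
  refine ⟨fun i => B (Sum.inr (e.symm i)), fun x h1 h2 => ?_⟩
  rw [← Module.forall_dual_apply_eq_zero_iff ℝ]
  intro φ
  have : φ ∈ Submodule.span ℝ (range B) := by rw [B.span_eq]; trivial
  induction this using Submodule.span_induction with
  | mem y hy =>
    obtain ⟨i | i, rfl⟩ := hy
    · have := h1 i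
      simp only [B, Module.Basis.sumExtend, Module.Basis.coe_reindex, Module.Basis.coe_extend, Function.comp_apply]
      exact this
    · simpa using h2 (e i)
  | zero => simp
  | add _ _ _ _ h1 h2 => simp [h1, h2]
  | smul _ _ _ h1 => simp [h1]

lemma local_diffeo {k : ℕ} (G : EucSp k → EucSp k) (hG : ContDiff ℝ 1 G) (x₀ : EucSp k)
    (hinj : ∀ v, fderiv ℝ G x₀ v = 0 → v = 0) :
    ∃ (U : Set (EucSp k)) (Ginv : EucSp k → EucSp k), x₀ ∈ U ∧ IsBiLipC1DiffeoOn G Ginv U := by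
  let l : EucSp k ≃ₗ[ℝ] EucSp k := LinearEquiv.ofInjectiveEndo (fderiv ℝ G x₀ : EucSp k →ₗ[ℝ] EucSp k)
    ((injective_iff_map_eq_zero _).2 hinj)
  let L : EucSp k ≃L[ℝ] EucSp k := l.toContinuousLinearEquiv
  have hL : HasFDerivAt G (L : EucSp k →L[ℝ] EucSp k) x₀ := by
    have : (L : EucSp k →L[ℝ] EucSp k) = fderiv ℝ G x₀ := by ext v; rfl
    rw [this]
    exact (hG.differentiable one_ne_zero x₀).hasFDerivAt
  let e := hG.contDiffAt.toOpenPartialHomeomorph G hL one_ne_zero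
  have he : (e : EucSp k → EucSp k) = G := rfl
  have hx : x₀ ∈ e.source := hG.contDiffAt.mem_toOpenPartialHomeomorph_source hL one_ne_zero
  have hinv : ContDiffAt ℝ 1 e.symm (G x₀) := hG.contDiffAt.to_localInverse hL one_ne_zero
  obtain ⟨K1, t1, ht1, hl1⟩ := hG.contDiffAt.exists_lipschitzOnWith (x := x₀)
  obtain ⟨K2, t2, ht2, hl2⟩ := hinv.exists_lipschitzOnWith
  have hev := hinv.eventually (by simp)
  obtain ⟨V, hVs, hVo, hV⟩ := _root_.mem_nhds_iff.1 (Filter.inter_mem ht2 hev)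
  obtain ⟨T, hTs, hTo, hT⟩ := _root_.mem_nhds_iff.1 ht1
  refine ⟨e.source ∩ (T ∩ G ⁻¹' V), e.symm, ⟨hx, hT, hV⟩, ?_, ?_, ?_, ?_, ?_, ?_, max K1 K2, ?_, ?_⟩
  · exact e.open_source.inter (hTo.inter (hVo.preimage hG.continuous))
  · exact e.isOpen_image_of_subset_source
      (e.open_source.inter (hTo.inter (hVo.preimage hG.continuous))) inter_subset_left
  · intro x hx; exact e.left_inv hx.1
  · rintro _ ⟨x, hx, rfl⟩
    exact congrArg G (e.left_inv hx.1)
  · exact hG.contDiffOn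
  · rintro _ ⟨x, hx, rfl⟩
    have h1 : ContDiffAt ℝ 1 e.symm (G x) := by simpa using (hVs hx.2.2).2
    exact h1.contDiffWithinAt
  · exact (hl1.mono (fun x hx => hTs hx.2.1)).weaken (le_max_left _ _)
  · refine (hl2.mono ?_).weaken (le_max_right _ _)
    rintro _ ⟨x, hx, rfl⟩
    exact (hVs hx.2.2).1

lemma unif_diff {k j : ℕ} {u : EucSp k → (Fin j → ℝ)} {c : ℝ≥0} (hu : LipschitzWith c u)
    {B : Set (EucSp k)} (hB : MeasurableSet B) (hBf : volume B ≠ ∞) {η : ℝ} (hη : 0 < η)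
    {ε : ℝ≥0∞} (hε : 0 < ε) :
    ∃ M : Set (EucSp k), MeasurableSet M ∧ volume (B \ M) ≤ ε ∧ ∃ s > 0, ∀ x ∈ M, ∀ h : EucSp k,
      ‖h‖ < s → ‖u (x + h) - u x - fderiv ℝ u x h‖ ≤ η * ‖h‖ := by
  let r : ℕ → ℝ := fun n => 1 / ((n:ℝ) + 1)
  have hr : ∀ n, 0 < r n := fun n => by positivity
  have hrm : Antitone r := fun a b hab => one_div_le_one_div_of_le (by positivity)
    (by gcongr)
  let M : ℕ → Set (EucSp k) := fun n => ⋂ i : ℕ, {x | ‖TopologicalSpace.denseSeq (EucSp k) i‖ < r n →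
    ‖u (x + TopologicalSpace.denseSeq (EucSp k) i) - u x
      - fderiv ℝ u x (TopologicalSpace.denseSeq (EucSp k) i)‖ ≤
      η * ‖TopologicalSpace.denseSeq (EucSp k) i‖}
  have hM : ∀ n x, x ∈ M n ↔ ∀ h : EucSp k, ‖h‖ < r n →
      ‖u (x + h) - u x - fderiv ℝ u x h‖ ≤ η * ‖h‖ := by
    intro n x
    simp only [M, mem_iInter, mem_ofPred_eq]
    constructor
    · intro H h hh
      have hcl : h ∈ closure (ball 0 (r n) ∩ range (TopologicalSpace.denseSeq (EucSp k))) :=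
        (TopologicalSpace.denseRange_denseSeq (EucSp k)).open_subset_closure_inter isOpen_ball
          (by simpa using hh)
      have hc1 : IsClosed {h : EucSp k | ‖u (x + h) - u x - fderiv ℝ u x h‖ ≤ η * ‖h‖} := by
        have := hu.continuous
        apply isClosed_le <;> fun_prop
      refine (closure_minimal ?_ hc1) hcl
      rintro _ ⟨h1, i, rfl⟩
      exact H i (by simpa using h1)
    · intro H i hi
      exact H _ hi
  have hMm : ∀ n, MeasurableSet (M n) := by
    intro n
    refine MeasurableSet.iInter fun i => ?_
    by_cases hi : ‖TopologicalSpace.denseSeq (EucSp k) i‖ < r n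
    · simp only [hi, true_imp_iff]
      have h1 := hu.continuous
      have h2 : Measurable (fun x => fderiv ℝ u x (TopologicalSpace.denseSeq (EucSp k) i)) :=
        measurable_fderiv_apply_const ℝ u _
      have h3 : Measurable u := h1.measurable
      refine measurableSet_le ?_ measurable_const
      exact (((h3.comp (measurable_id.add_const _)).sub h3).sub h2).norm
    · simp [hi]
  have hanti : Antitone fun n => B \ M n := by
    intro a b hab
    refine sdiff_subset_sdiff_right fun x hx => ?_
    rw [hM] at hx ⊢
    exact fun h hh => hx h (hh.trans_le (hrm hab))
  have hlim := tendsto_measure_iInter_atTop (μ := (volume : Measure (EucSp k)))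
    (fun n => (hB.diff (hMm n)).nullMeasurableSet) hanti
    ⟨0, ne_top_of_le_ne_top hBf (measure_mono sdiff_subset)⟩
  have hz : volume (⋂ n, B \ M n) = 0 := by
    refine measure_mono_null ?_ hu.ae_differentiableAt
    intro x hx hd
    have hd : DifferentiableAt ℝ u x := by simpa using hd
    have h1 := (hasFDerivAt_iff_isLittleO_nhds_zero.1 hd.hasFDerivAt).def hη
    obtain ⟨δ, hδ, h2⟩ := Metric.eventually_nhds_iff.1 h1
    obtain ⟨n, hn⟩ := exists_nat_one_div_lt hδ
    refine (mem_iInter.1 hx n).2 ((hM n x).2 fun h hh => h2 ?_)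
    rw [dist_zero_right]
    exact hh.trans hn
  rw [hz] at hlim
  obtain ⟨n, hn⟩ := (hlim.eventually (Iic_mem_nhds hε)).exists
  exact ⟨M n, hMm n, hn, r n, hr n, fun x hx => (hM n x).1 hx⟩

open scoped Convolution in
/-- Mollification with a normed bump function. -/
def moll {k : ℕ} {F : Type*} [NormedAddCommGroup F] [NormedSpace ℝ F]
    (φ : ContDiffBump (0 : EucSp k)) (u : EucSp k → F) : EucSp k → F :=
  φ.normed volume ⋆[ContinuousLinearMap.lsmul ℝ ℝ, volume] u

section moll
variable {k j : ℕ} (φ : ContDiffBump (0 : EucSp k))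

lemma moll_apply {F : Type*} [NormedAddCommGroup F] [NormedSpace ℝ F] (u : EucSp k → F)
    (x : EucSp k) : moll φ u x = ∫ t, φ.normed volume t • u (x - t) := by
  simp [moll, MeasureTheory.convolution]

lemma moll_contDiff {F : Type*} [NormedAddCommGroup F] [NormedSpace ℝ F] [CompleteSpace F]
    {u : EucSp k → F}
    (hu : LocallyIntegrable u) : ContDiff ℝ 1 (moll φ u) :=
  φ.hasCompactSupport_normed.contDiff_convolution_left _ φ.contDiff_normed hu

lemma integrable_moll_cont {F : Type*} [NormedAddCommGroup F] [NormedSpace ℝ F] {u : EucSp k → F}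
    (hu : Continuous u) (x : EucSp k) : Integrable fun t => φ.normed volume t • u (x - t) := by
  refine Continuous.integrable_of_hasCompactSupport ?_ ?_
  · exact φ.continuous_normed.smul (hu.comp (by fun_prop))
  · exact φ.hasCompactSupport_normed.smul_right

lemma integrable_moll_bdd {F : Type*} [NormedAddCommGroup F] [NormedSpace ℝ F] {u : EucSp k → F}
    (hu : StronglyMeasurable u) (C : ℝ) (hC : ∀ x, ‖u x‖ ≤ C) (x : EucSp k) :
    Integrable fun t => φ.normed volume t • u (x - t) := by
  refine (φ.integrable_normed (μ := volume)).smul_bdd C ?_ ?_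
  · exact (hu.comp_measurable (measurable_const.sub measurable_id)).aestronglyMeasurable
  · exact Eventually.of_forall fun t => hC _

lemma locInt_bdd {F : Type*} [NormedAddCommGroup F] {u : EucSp k → F}
    (hu : StronglyMeasurable u) (C : ℝ) (hC : ∀ x, ‖u x‖ ≤ C) : LocallyIntegrable u := by
  refine (locallyIntegrable_const C).mono hu.aestronglyMeasurable (Eventually.of_forall fun x => ?_)
  exact (hC x).trans (le_abs_self C)

lemma moll_lip {u : EucSp k → (Fin j → ℝ)} {c : ℝ≥0} (hu : LipschitzWith c u) :
    LipschitzWith c (moll φ u) := by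
  refine LipschitzWith.of_dist_le_mul fun x y => ?_
  rw [dist_eq_norm, moll_apply, moll_apply, ← integral_sub (integrable_moll_cont φ hu.continuous x)
    (integrable_moll_cont φ hu.continuous y)]
  calc _ ≤ ∫ t, φ.normed volume t * (c * dist x y) := by
        refine norm_integral_le_of_norm_le (φ.integrable_normed.mul_const _)
          (Eventually.of_forall fun t => ?_)
        rw [← smul_sub, norm_smul, Real.norm_of_nonneg (φ.nonneg_normed t)]
        refine mul_le_mul_of_nonneg_left ?_ (φ.nonneg_normed t)
        rw [← dist_eq_norm]
        simpa using hu.dist_le_mul (x - t) (y - t)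
    _ = c * dist x y := by
        rw [integral_mul_const, φ.integral_normed, one_mul]

lemma moll_dist {u : EucSp k → (Fin j → ℝ)} {c : ℝ≥0} (hu : LipschitzWith c u) (x : EucSp k) :
    ‖moll φ u x - u x‖ ≤ c * φ.rOut := by
  rw [← dist_eq_norm]
  refine φ.dist_normed_convolution_le hu.continuous.aestronglyMeasurable fun y hy => ?_
  refine (hu.dist_le_mul y x).trans ?_
  gcongr
  exact (mem_ball.1 hy).le

lemma moll_deriv {u : EucSp k → (Fin j → ℝ)} {c : ℝ≥0} (hu : LipschitzWith c u)
    {M : Set (EucSp k)} (hM : MeasurableSet M) {η s : ℝ} (hη : 0 ≤ η)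
    (H : ∀ x ∈ M, ∀ h : EucSp k,
      ‖h‖ < s → ‖u (x + h) - u x - fderiv ℝ u x h‖ ≤ η * ‖h‖) (x h : EucSp k) (hh : ‖h‖ < s) :
    ‖moll φ u (x + h) - moll φ u x - moll φ (fderiv ℝ u) x h‖ ≤
      (η + 2 * c * moll φ (Mᶜ.indicator (fun _ => (1:ℝ))) x) * ‖h‖ := by
  have hb : ∀ x, ‖fderiv ℝ u x‖ ≤ c := fun x => norm_fderiv_le_of_lipschitz ℝ hu
  have hD : StronglyMeasurable (fderiv ℝ u) := (measurable_fderiv ℝ u).stronglyMeasurable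
  have hI : StronglyMeasurable (Mᶜ.indicator (fun _ : EucSp k => (1:ℝ))) :=
    (measurable_const.indicator hM.compl).stronglyMeasurable
  have hIb : ∀ x, ‖Mᶜ.indicator (fun _ : EucSp k => (1:ℝ)) x‖ ≤ 1 := by
    intro x
    by_cases hx : x ∈ Mᶜ <;> simp [hx]
  have i1 := integrable_moll_cont φ hu.continuous (x + h)
  have i2 := integrable_moll_cont φ hu.continuous x
  have i3 := integrable_moll_bdd φ hD c hb x
  have i4 := integrable_moll_bdd φ hI 1 hIb x
  have i3' : Integrable fun t => (φ.normed volume t • fderiv ℝ u (x - t)) h :=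
    i3.apply_continuousLinearMap h
  have i12 : Integrable fun t => φ.normed volume t • u (x + h - t) - φ.normed volume t • u (x - t) :=
    i1.sub i2
  rw [moll_apply, moll_apply, moll_apply, moll_apply, ContinuousLinearMap.integral_apply i3,
    ← integral_sub i1 i2, ← integral_sub i12 i3']
  calc _ ≤ ∫ t, (φ.normed volume t * η + 2 * c * (φ.normed volume t •
          Mᶜ.indicator (fun _ => (1:ℝ)) (x - t))) * ‖h‖ := by
        refine norm_integral_le_of_norm_le
          (((φ.integrable_normed.mul_const _).add (i4.const_mul _)).mul_const _)
          (Eventually.of_forall fun t => ?_)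
        have h0 := φ.nonneg_normed (μ := volume) t
        rw [smul_apply, ← smul_sub, ← smul_sub, norm_smul,
          Real.norm_of_nonneg h0]
        have e : (φ.normed volume t * η + 2 * c * (φ.normed volume t •
          Mᶜ.indicator (fun _ => (1:ℝ)) (x - t))) * ‖h‖ = φ.normed volume t *
            ((η + 2 * c * Mᶜ.indicator (fun _ => (1:ℝ)) (x - t)) * ‖h‖) := by
          rw [smul_eq_mul]; ring
        rw [e]
        refine mul_le_mul_of_nonneg_left ?_ h0
        by_cases hx : x - t ∈ M
        · have := H _ hx h hh
          rw [show x + h - t = x - t + h by abel]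
          simpa [hx] using this
        · have h1 : ‖u (x + h - t) - u (x - t)‖ ≤ c * ‖h‖ := by
            have := hu.dist_le_mul (x + h - t) (x - t)
            rw [dist_eq_norm, dist_eq_norm] at this
            rwa [show x + h - t - (x - t) = h by abel] at this
          have h2 : ‖fderiv ℝ u (x - t) h‖ ≤ c * ‖h‖ :=
            (fderiv ℝ u (x - t)).le_of_opNorm_le (hb _) h
          have h3 := norm_sub_le (u (x + h - t) - u (x - t)) (fderiv ℝ u (x - t) h)
          have h4 : 0 ≤ η * ‖h‖ := by positivity
          have h5 : Mᶜ.indicator (fun _ => (1:ℝ)) (x - t) = 1 := by simp [hx]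
          rw [h5]
          linarith
    _ = _ := by
        rw [integral_mul_const, integral_add (φ.integrable_normed.mul_const _) (i4.const_mul _),
          integral_mul_const, φ.integral_normed, one_mul, integral_const_mul]
end moll

lemma egorov_one {k : ℕ} {F : Type*} [NormedAddCommGroup F] {B : Set (EucSp k)}
    (hB : MeasurableSet B) (hBf : volume B ≠ ∞) {g : ℕ → EucSp k → F} {f : EucSp k → F}
    (hg : ∀ n, StronglyMeasurable (g n)) (hf : StronglyMeasurable f)
    (hlim : ∀ᵐ x, Tendsto (fun n => g n x) atTop (𝓝 (f x))) {ε : ℝ≥0∞} (hε : 0 < ε) :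
    ∃ P ⊆ B, MeasurableSet P ∧ volume (B \ P) ≤ ε ∧
      ∀ δ : ℝ, 0 < δ → ∀ᶠ n in atTop, ∀ x ∈ P, ‖f x - g n x‖ ≤ δ := by
  obtain ⟨ε', h0, h1⟩ : ∃ ε' : ℝ, 0 < ε' ∧ ENNReal.ofReal ε' ≤ ε := by
    obtain ⟨q, hq, hq'⟩ := ENNReal.lt_iff_exists_nnreal_btwn.1 hε
    exact ⟨q, by simpa using hq, by simpa using hq'.le⟩
  obtain ⟨t, ht, htm, hv, hu⟩ := tendstoUniformlyOn_of_ae_tendsto hg hf hB hBf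
    (hlim.mono fun x hx _ => hx) h0
  refine ⟨B \ t, sdiff_subset, hB.diff htm, ?_, ?_⟩
  · refine (measure_mono ?_).trans (hv.trans h1)
    intro x hx
    by_contra hc
    exact hx.2 ⟨hx.1, hc⟩
  · intro δ hδ
    filter_upwards [Metric.tendstoUniformlyOn_iff.1 hu δ hδ] with n hn x hx
    rw [← dist_eq_norm]
    exact (hn x hx).le

lemma lusin_step {k j : ℕ} {u : EucSp k → (Fin j → ℝ)} {c : ℝ≥0} (hc : 0 < c)
    (hu : LipschitzWith c u)
    {B : Set (EucSp k)} (hB : MeasurableSet B) (hBf : volume B ≠ ∞)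
    {ε : ℝ≥0∞} (hε : 0 < ε) :
    ∃ P ⊆ B, MeasurableSet P ∧ volume (B \ P) ≤ ε ∧ ∃ g u' : EucSp k → (Fin j → ℝ),
      ContDiff ℝ 1 g ∧ LipschitzWith c g ∧ g 0 = 0 ∧ LipschitzWith (c / 2) u' ∧
      ∀ x ∈ P, u x = g x + u' x := by
  have hc' : (0:ℝ) < c := hc
  have hε3 : 0 < ε / 3 := ENNReal.div_pos hε.ne' (by simp)
  obtain ⟨M, hM, hMv, s, hs, H⟩ := unif_diff hu hB hBf (η := c / 8) (by positivity) hε3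
  let φ : ℕ → ContDiffBump (0 : EucSp k) := fun n =>
    ⟨1 / ((n:ℝ) + 1), 2 * (1 / ((n:ℝ) + 1)), by positivity, by
      have : (0:ℝ) < 1 / ((n:ℝ) + 1) := by positivity
      linarith⟩
  have hφ : Tendsto (fun n => (φ n).rOut) atTop (𝓝 0) := by
    have : Tendsto (fun n : ℕ => 2 * (1 / ((n:ℝ) + 1))) atTop (𝓝 (2 * 0)) :=
      tendsto_one_div_add_atTop_nhds_zero_nat.const_mul 2
    rw [mul_zero] at this
    exact this
  have hφ' : ∀ᶠ n in atTop, (φ n).rOut ≤ 2 * (φ n).rIn := Eventually.of_forall fun n => le_rfl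
  have hb : ∀ x, ‖fderiv ℝ u x‖ ≤ c := fun x => norm_fderiv_le_of_lipschitz ℝ hu
  have hD : StronglyMeasurable (fderiv ℝ u) := (measurable_fderiv ℝ u).stronglyMeasurable
  have hI : StronglyMeasurable (Mᶜ.indicator (fun _ : EucSp k => (1:ℝ))) :=
    (measurable_const.indicator hM.compl).stronglyMeasurable
  have hIb : ∀ x, ‖Mᶜ.indicator (fun _ : EucSp k => (1:ℝ)) x‖ ≤ 1 := by
    intro x
    by_cases hx : x ∈ Mᶜ <;> simp [hx]
  have lD := locInt_bdd hD c hb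
  have lI := locInt_bdd hI 1 hIb
  obtain ⟨P1, hP1, hP1m, hP1v, H1⟩ := egorov_one hB hBf
    (g := fun n => moll (φ n) (fderiv ℝ u))
    (fun n => (moll_contDiff (φ n) lD).continuous.stronglyMeasurable) hD
    (ContDiffBump.ae_convolution_tendsto_right_of_locallyIntegrable hφ hφ' lD) hε3
  obtain ⟨P2, hP2, hP2m, hP2v, H2⟩ := egorov_one hB hBf
    (g := fun n => moll (φ n) (Mᶜ.indicator (fun _ : EucSp k => (1:ℝ))))
    (fun n => (moll_contDiff (φ n) lI).continuous.stronglyMeasurable) hI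
    (ContDiffBump.ae_convolution_tendsto_right_of_locallyIntegrable hφ hφ' lI) hε3
  obtain ⟨n, ⟨h1, h2⟩, h3⟩ := (((H1 (c / 8) (by positivity)).and (H2 (1 / 16) (by norm_num))).and
    (hφ.eventually (Iic_mem_nhds (show (0:ℝ) < s / 4 by positivity)))).exists
  have h3 : (φ n).rOut ≤ s / 4 := by simpa using h3
  set g := moll (φ n) u with hg
  have hgL := moll_lip (φ n) hu
  have hgd := moll_dist (φ n) hu
  have hgD := moll_deriv (φ n) hu hM (η := c / 8) (by positivity) H
  have hlip : LipschitzOnWith (c / 2) (fun x => u x - g x) (M ∩ P1 ∩ P2) := by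
    refine LipschitzOnWith.of_dist_le_mul fun y hy x hx => ?_
    rw [dist_eq_norm, dist_eq_norm]
    push_cast
    rcases lt_or_ge ‖y - x‖ s with hlt | hge
    · have e1 := H x hx.1.1 (y - x) hlt
      have e2 := hgD x (y - x) hlt
      have e3 := (fderiv ℝ u x - moll (φ n) (fderiv ℝ u) x).le_of_opNorm_le (h1 x hx.1.2) (y - x)
      have e4 := h2 x hx.2
      have e5 : moll (φ n) (Mᶜ.indicator (fun _ : EucSp k => (1:ℝ))) x ≤ 1 / 16 := by
        have : Mᶜ.indicator (fun _ : EucSp k => (1:ℝ)) x = 0 := by simp [hx.1.1]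
        rw [this, zero_sub, norm_neg] at e4
        exact (le_abs_self _).trans e4
      rw [add_sub_cancel] at e1 e2
      have e6 : (c / 8 + 2 * c * moll (φ n) (Mᶜ.indicator (fun _ : EucSp k => (1:ℝ))) x) * ‖y - x‖
          ≤ (c / 8 + 2 * c * (1 / 16)) * ‖y - x‖ := by gcongr
      have e7 : u y - g y - (u x - g x) = (u y - u x - fderiv ℝ u x (y - x)) +
          (fderiv ℝ u x - moll (φ n) (fderiv ℝ u) x) (y - x) -
          (g y - g x - moll (φ n) (fderiv ℝ u) x (y - x)) := by
        rw [sub_apply]; abel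
      rw [e7]
      refine (norm_sub_le _ _).trans ?_
      have e8 := norm_add_le (u y - u x - fderiv ℝ u x (y - x))
          ((fderiv ℝ u x - moll (φ n) (fderiv ℝ u) x) (y - x))
      have e9 := e2.trans e6
      linarith
    · have e1 := hgd x
      have e2 := hgd y
      have e7 : u y - g y - (u x - g x) = (g x - u x) - (g y - u y) := by abel
      rw [e7]
      refine (norm_sub_le _ _).trans ?_
      have : (c:ℝ) * (φ n).rOut ≤ c * (‖y - x‖ / 4) := by gcongr; linarith
      linarith
  obtain ⟨v, hv, hve⟩ := hlip.extend_pi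
  refine ⟨B ∩ (M ∩ P1 ∩ P2), inter_subset_left, hB.inter ((hM.inter hP1m).inter hP2m), ?_,
    fun x => g x - g 0, fun x => v x + g 0, ?_, ?_, by simp, ?_, ?_⟩
  · have : B \ (B ∩ (M ∩ P1 ∩ P2)) ⊆ (B \ M ∪ B \ P1) ∪ B \ P2 := by
      intro x hx
      by_contra hcon
      simp only [mem_union, Set.mem_sdiff, not_or, not_and, not_not] at hcon
      exact hx.2 ⟨hx.1, ⟨hcon.1.1 hx.1, hcon.1.2 hx.1⟩, hcon.2 hx.1⟩
    calc volume (B \ (B ∩ (M ∩ P1 ∩ P2))) ≤ volume ((B \ M ∪ B \ P1) ∪ B \ P2) := measure_mono this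
      _ ≤ volume (B \ M) + volume (B \ P1) + volume (B \ P2) :=
          (measure_union_le _ _).trans (by gcongr; exact measure_union_le _ _)
      _ ≤ ε / 3 + ε / 3 + ε / 3 := by gcongr
      _ = ε := ENNReal.add_thirds ε
  · exact (moll_contDiff (φ n) hu.continuous.locallyIntegrable).sub contDiff_const
  · refine LipschitzWith.of_dist_le_mul fun x y => ?_
    simpa using hgL.dist_le_mul x y
  · refine LipschitzWith.of_dist_le_mul fun x y => ?_
    simpa using hv.dist_le_mul x y
  · intro x hx
    have := hve hx.2
    simp only at this ⊢
    rw [← this]; abel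

lemma lusin_C1 {k j : ℕ} {u : EucSp k → (Fin j → ℝ)} {c : ℝ≥0} (hc : 0 < c)
    (hu : LipschitzWith c u)
    {B : Set (EucSp k)} (hB : MeasurableSet B) (hBf : volume B ≠ ∞)
    {ε : ℝ≥0∞} (hε : 0 < ε) :
    ∃ K ⊆ B, MeasurableSet K ∧ volume (B \ K) ≤ ε ∧ ∃ g : EucSp k → (Fin j → ℝ),
      ContDiff ℝ 1 g ∧ ∀ x ∈ K, u x = g x := by
  obtain ⟨e, he, hes⟩ := ENNReal.exists_pos_sum_of_countable' hε.ne' ℕ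
  have step : ∀ (n : ℕ) (v : {v : EucSp k → (Fin j → ℝ) // LipschitzWith (c / 2 ^ n) v}),
      ∃ (P : Set (EucSp k)) (g : EucSp k → (Fin j → ℝ))
        (v' : {v : EucSp k → (Fin j → ℝ) // LipschitzWith (c / 2 ^ (n + 1)) v}),
        P ⊆ B ∧ MeasurableSet P ∧ volume (B \ P) ≤ e n ∧ ContDiff ℝ 1 g ∧
        LipschitzWith (c / 2 ^ n) g ∧ g 0 = 0 ∧ ∀ x ∈ P, v.1 x = g x + v'.1 x := by
    intro n v
    obtain ⟨P, h1, h2, h3, g, v', h4, h5, h6, h7, h8⟩ :=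
      lusin_step (c := c / 2 ^ n) (by positivity) v.2 hB hBf (he n)
    refine ⟨P, g, ⟨v', ?_⟩, h1, h2, h3, h4, h5, h6, h8⟩
    rwa [pow_succ, ← div_div]
  choose P g v' h1 h2 h3 h4 h5 h6 h7 using step
  let W : ∀ n : ℕ, {v : EucSp k → (Fin j → ℝ) // LipschitzWith (c / 2 ^ n) v} := fun n =>
    Nat.rec ⟨u, by simpa using hu⟩ (fun n v => v' n v) n
  have W0 : (W 0).1 = u := rfl
  have WS : ∀ n, W (n + 1) = v' n (W n) := fun n => rfl
  let G : ℕ → EucSp k → (Fin j → ℝ) := fun n => g n (W n)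
  let K : Set (EucSp k) := ⋂ n, P n (W n)
  have hKm : MeasurableSet K := MeasurableSet.iInter fun n => h2 _ _
  have hKB : K ⊆ B := fun x hx => h1 _ _ (mem_iInter.1 hx 0)
  have hKv : volume (B \ K) ≤ ε := by
    have : B \ K ⊆ ⋃ n, B \ P n (W n) := by rw [← sdiff_iInter]
    calc volume (B \ K) ≤ ∑' n, volume (B \ P n (W n)) :=
          (measure_mono this).trans (measure_iUnion_le _)
      _ ≤ ∑' n, e n := ENNReal.tsum_le_tsum fun n => h3 _ _
      _ ≤ ε := hes.le
  have hsum : Summable fun n : ℕ => (c : ℝ) / 2 ^ n := by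
    have := (summable_geometric_two).mul_left (c : ℝ)
    refine this.congr fun n => ?_
    rw [div_pow, one_pow]; ring
  have hd : ∀ n x, HasFDerivAt (G n) (fderiv ℝ (G n) x) x := fun n x =>
    ((h4 n (W n)).differentiable one_ne_zero x).hasFDerivAt
  have hdb : ∀ n x, ‖fderiv ℝ (G n) x‖ ≤ (c : ℝ) / 2 ^ n := fun n x => by
    simpa using norm_fderiv_le_of_lipschitz ℝ (x₀ := x) (h5 n (W n))
  have hG0 : Summable fun n => G n 0 := by
    have : (fun n => G n 0) = fun _ => 0 := funext fun n => h6 n (W n)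
    rw [this]; exact summable_zero
  have hGs : ∀ x, Summable fun n => G n x := fun x =>
    summable_of_summable_hasFDerivAt hsum hd hdb hG0 x
  have hGd := hasFDerivAt_tsum hsum hd hdb hG0
  have hGC : ContDiff ℝ 1 (fun y => ∑' n, G n y) := by
    rw [contDiff_one_iff_fderiv]
    refine ⟨fun x => (hGd x).differentiableAt, ?_⟩
    have : fderiv ℝ (fun y => ∑' n, G n y) = fun x => ∑' n, fderiv ℝ (G n) x :=
      funext fun x => (hGd x).fderiv
    rw [this]
    exact continuous_tsum (fun n => (h4 n (W n)).continuous_fderiv one_ne_zero) hsum hdb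
  refine ⟨K, hKB, hKm, hKv, ?_⟩
  rcases K.eq_empty_or_nonempty with hK | ⟨p, hp⟩
  · exact ⟨0, contDiff_const, by simp [hK]⟩
  refine ⟨fun x => (∑' n, G n x) + (u p - ∑' n, G n p), hGC.add contDiff_const, fun x hx => ?_⟩
  have hfin : ∀ N, ∀ y ∈ K, u y = ∑ n ∈ Finset.range N, G n y + (W N).1 y := by
    intro N y hy
    induction N with
    | zero => simp [W0]
    | succ N ih =>
      rw [ih, Finset.sum_range_succ, h7 N (W N) y (mem_iInter.1 hy N), WS, add_assoc]
  have t1 := (hGs x).hasSum.tendsto_sum_nat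
  have t2 := (hGs p).hasSum.tendsto_sum_nat
  have t3 : Tendsto (fun N => (W N).1 x - (W N).1 p) atTop (𝓝 0) := by
    have h0 : Tendsto (fun n : ℕ => (c : ℝ) / 2 ^ n * dist x p) atTop (𝓝 0) := by
      simpa using hsum.tendsto_atTop_zero.mul_const (dist x p)
    refine squeeze_zero_norm (fun N => ?_) h0
    have := (W N).2.dist_le_mul x p
    rw [dist_eq_norm] at this
    simpa using this
  have t4 := (t1.sub t2).add t3
  have t5 : (fun N => (∑ n ∈ Finset.range N, G n x - ∑ n ∈ Finset.range N, G n p) +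
      ((W N).1 x - (W N).1 p)) = fun _ => u x - u p := by
    funext N
    rw [hfin N x hx, hfin N p hp]; abel
  rw [t5] at t4
  have := tendsto_nhds_unique tendsto_const_nhds t4
  rw [add_zero] at this
  have h' : u x = (u x - u p) + u p := by abel
  rw [h', this]; abel_nf

lemma approxDeriv_eq {k : ℕ} {A : Set (EucSp k)} {f F : EucSp k → ℝ} (hfF : EqOn f F A)
    {L : EucSp k →ₗ[ℝ] ℝ} {x : EucSp k} (hx : x ∈ A) (h : HasApproxDerivWithinAt A f L x)
    (hF : DifferentiableAt ℝ F x) : L = (fderiv ℝ F x : EucSp k →ₗ[ℝ] ℝ) := by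
  obtain ⟨s, hsA, hsm, hd, ht⟩ := h
  have hu := uniqueDiff_of_isDensityPoint hd
  have h1 : HasFDerivWithinAt F (LinearMap.toContinuousLinearMap L) s x := by
    rw [hasFDerivWithinAt_iff_tendsto]
    refine ht.congr' ?_
    filter_upwards [self_mem_nhdsWithin] with y hy
    rw [hfF (hsA hy), hfF hx, Real.norm_eq_abs, div_eq_inv_mul]
    rfl
  have h2 := hu.eq h1 hF.hasFDerivAt.hasFDerivWithinAt
  rw [← h2]
  rfl

/-- Lemma 3.1: if `f : A → ℓ^∞` is Lipschitz on a measurable set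
`A ⊆ ℝ^k` and `rank (ap Df(x)) ≥ j` on a subset of positive measure, then there are an
open `U`, a set `K ⊆ A ∩ U` of positive measure, a bi-Lipschitz `C¹`-diffeomorphism
`G : U → G(U)` and a permutation `Ψ` of finitely many coordinates of `ℓ^∞` with
`(Ψ ∘ f ∘ G⁻¹)ᵢ(x) = xᵢ` for `i = 1,…,j` on `G(K)`. -/
theorem stmt5 {k j : ℕ}
    (A : Set (EucSp k)) (hA : MeasurableSet A)
    (f : EucSp k → LpInfty) (hf : ∃ L : ℝ≥0, LipschitzOnWith L f A)
    (hrank : 0 < volume {x ∈ A | ∃ D : EucSp k →ₗ[ℝ] (ℕ → ℝ),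
      HasCompApproxDerivWithinAt A f D x ∧ (j : Cardinal) ≤ LinearMap.rank D}) :
    ∃ (U : Set (EucSp k)) (K : Set (EucSp k))
      (G Ginv : EucSp k → EucSp k) (Ψ : LpInfty → LpInfty),
      K ⊆ A ∩ U ∧ 0 < volume K ∧ IsBiLipC1DiffeoOn G Ginv U ∧ IsFinCoordPerm Ψ ∧
      ∀ x ∈ G '' K, ∀ i : Fin k, (i : ℕ) < j → Ψ (f (Ginv x)) (i : ℕ) = x i := by
  obtain ⟨C, hC⟩ := hf
  obtain ⟨F, hF, hfF⟩ := hC.extend_lp_infty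
  have hFi : ∀ i : ℕ, LipschitzWith C (fun x => F x i) := by
    intro i
    refine LipschitzWith.of_dist_le_mul fun x y => ?_
    refine le_trans ?_ (hF.dist_le_mul x y)
    rw [dist_eq_norm, dist_eq_norm]
    exact lp.norm_apply_le_norm (by simp) (F x - F y) i
  have hae : ∀ᵐ x : EucSp k, ∀ i : ℕ, DifferentiableAt ℝ (fun x => F x i) x :=
    ae_all_iff.2 fun i => (hFi i).ae_differentiableAt
  -- the sets on which given rows are linearly independent
  let S : (Fin j → ℕ) × ℕ → Set (EucSp k) := fun p => {x | x ∈ A ∩ ball 0 (p.2 : ℝ) ∧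
    Function.Injective p.1 ∧ (∀ i : ℕ, DifferentiableAt ℝ (fun x => F x i) x) ∧
    LinearIndependent ℝ (fun i => (fderiv ℝ (fun x => F x (p.1 i)) x : EucSp k →ₗ[ℝ] ℝ))}
  have hS : ∃ p, 0 < volume (S p) := by
    by_contra hcon
    push Not at hcon
    have hz : volume (⋃ p, S p) = 0 :=
      measure_iUnion_null fun p => le_antisymm (hcon p) (zero_le)
    refine hrank.ne' (measure_mono_null ?_ (measure_union_null hz hae))
    rintro x ⟨hxA, D, hD, hr⟩
    by_cases hx : ∀ i : ℕ, DifferentiableAt ℝ (fun x => F x i) x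
    · left
      obtain ⟨s, hs, hl⟩ := exists_rows D hr
      obtain ⟨n, hn⟩ := exists_nat_gt ‖x‖
      refine mem_iUnion.2 ⟨(s, n), ⟨hxA, by simpa using hn⟩, hs, hx, ?_⟩
      have : (fun i => (fderiv ℝ (fun x => F x (s i)) x : EucSp k →ₗ[ℝ] ℝ)) =
          fun i => (LinearMap.proj (s i)).comp D := by
        funext i
        refine (approxDeriv_eq (A := A) ?_ hxA (hD (s i)) (hx (s i))).symm
        intro y hy
        simp only [hfF hy]
      rw [this]
      exact hl
    · right
      exact hx
  obtain ⟨⟨s, n⟩, hSp⟩ := hS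
  set T := S (s, n) with hT
  have hTB : T ⊆ A ∩ ball 0 (n : ℝ) := fun x hx => hx.1
  have hs : Function.Injective s := by
    obtain ⟨x, hx⟩ := nonempty_of_measure_ne_zero hSp.ne'
    exact hx.2.1
  have hBm : MeasurableSet (A ∩ ball (0 : EucSp k) (n : ℝ)) := hA.inter measurableSet_ball
  have hBf : volume (A ∩ ball (0 : EucSp k) (n : ℝ)) ≠ ∞ :=
    ne_top_of_le_ne_top measure_ball_lt_top.ne (measure_mono inter_subset_right)
  have hTf : volume T ≠ ∞ := ne_top_of_le_ne_top hBf (measure_mono hTB)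
  have huL : LipschitzWith (C + 1) (fun x => fun i : Fin j => F x (s i)) := by
    refine LipschitzWith.weaken ?_ (show C ≤ C + 1 by simp)
    exact LipschitzWith.of_dist_le_mul fun x y =>
      (dist_pi_le_iff (by positivity)).2 fun i => (hFi (s i)).dist_le_mul x y
  obtain ⟨K, hKB, hKm, hKv, g, hg, hgK⟩ := lusin_C1 (by positivity) huL hBm hBf
    (ε := volume T / 2) (ENNReal.half_pos hSp.ne')
  have hKT : 0 < volume (K ∩ T) := by
    by_contra hcon
    have h0 : volume (K ∩ T) = 0 := by simpa using hcon
    have : T ⊆ ((A ∩ ball 0 (n : ℝ)) \ K) ∪ (K ∩ T) := by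
      intro x hx
      by_cases hxK : x ∈ K
      · exact Or.inr ⟨hxK, hx⟩
      · exact Or.inl ⟨hTB hx, hxK⟩
    have h1 : volume T ≤ volume T / 2 :=
      calc volume T ≤ volume ((A ∩ ball 0 (n : ℝ)) \ K) + volume (K ∩ T) :=
            (measure_mono this).trans (measure_union_le _ _)
        _ ≤ volume T / 2 := by rw [h0, add_zero]; exact hKv
    exact (ENNReal.half_lt_self hSp.ne' hTf).not_ge h1
  have hdens := Besicovitch.ae_tendsto_measure_inter_div_of_measurableSet
    (volume : Measure (EucSp k)) hKm
  obtain ⟨N, hN⟩ : ∃ N : Set (EucSp k), N = {x | UniqueDiffWithinAt ℝ K x} := ⟨_, rfl⟩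
  have hNK : ∀ᵐ x : EucSp k, x ∈ K → x ∈ N := by
    filter_upwards [hdens] with x hx hxK
    rw [hN]
    apply uniqueDiff_of_density
    simpa [hxK] using hx
  have hKTN : 0 < volume (K ∩ T ∩ N) := by
    refine hKT.trans_le (measure_mono_ae ?_)
    filter_upwards [hNK] with x hx hxK
    exact ⟨hxK, hx hxK.1⟩
  obtain ⟨x₀, hx₀, hpos⟩ := exists_mem_forall_mem_nhdsWithin_pos_measure hKTN.ne'
  obtain ⟨⟨hx₀K, hx₀T⟩, hx₀N⟩ := hx₀
  have hud : UniqueDiffWithinAt ℝ K x₀ := by rw [hN] at hx₀N; exact hx₀N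
  obtain ⟨-, -, hdiff, hli⟩ := hx₀T
  -- derivative of `g`
  have hgi : ∀ i : Fin j, ContDiff ℝ 1 (fun x => g x i) := fun i => contDiff_pi.1 hg i
  have hder : ∀ i : Fin j, fderiv ℝ (fun x => F x (s i)) x₀ = fderiv ℝ (fun x => g x i) x₀ := by
    intro i
    refine hud.eq (hdiff (s i)).hasFDerivAt.hasFDerivWithinAt ?_
    refine ((hgi i).differentiable one_ne_zero x₀).hasFDerivAt.hasFDerivWithinAt.congr ?_ ?_
    · exact fun y hy => congrFun (hgK y hy) i
    · exact congrFun (hgK x₀ hx₀K) i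
  have hjk : j ≤ k := by
    have := hli.fintype_card_le_finrank
    have h2 : Module.finrank ℝ (EucSp k →ₗ[ℝ] ℝ) = k := by
      have := Subspace.dual_finrank_eq (K := ℝ) (V := EucSp k)
      rw [finrank_euclideanSpace_fin] at this
      exact this
    rw [h2] at this
    simpa using this
  obtain ⟨m, rfl⟩ := Nat.exists_eq_add_of_le hjk
  obtain ⟨b, hb⟩ := exists_extend _ hli
  let G : EucSp (j + m) → EucSp (j + m) := fun x =>
    WithLp.toLp 2 (Fin.addCases (fun i => g x i) (fun i => b i x))
  have hGl : ∀ x i, G x (Fin.castAdd m i) = g x i := fun x i => by simp [G]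
  have hGr : ∀ x i, G x (Fin.natAdd j i) = b i x := fun x i => by simp [G]
  have hbc : ∀ i, ContDiff ℝ 1 (fun x => b i x) := fun i =>
    (LinearMap.toContinuousLinearMap (b i)).contDiff
  have hG : ContDiff ℝ 1 G := by
    rw [contDiff_euclidean]
    intro i
    refine Fin.addCases (fun i => ?_) (fun i => ?_) i
    · simp only [hGl]; exact hgi i
    · simp only [hGr]; exact hbc i
  have hGd := (hG.differentiable one_ne_zero x₀).hasFDerivAt
  have hcomp : ∀ i v, fderiv ℝ G x₀ v i = fderiv ℝ (fun x => G x i) x₀ v := by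
    intro i v
    have h1 := (EuclideanSpace.proj i : EucSp (j + m) →L[ℝ] ℝ).hasFDerivAt.comp
      x₀ hGd
    have h2 : fderiv ℝ (fun x => G x i) x₀ = _ := h1.fderiv
    rw [h2]
    rfl
  obtain ⟨U, Ginv, hxU, hdf⟩ := local_diffeo G hG x₀ (by
    intro v hv
    have hv' : ∀ i, fderiv ℝ (fun x => G x i) x₀ v = 0 := by
      intro i; rw [← hcomp, hv]; rfl
    refine hb v (fun i => ?_) (fun i => ?_)
    · have := hv' (Fin.castAdd m i)
      simp only [hGl] at this
      rw [← hder] at this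
      exact this
    · have := hv' (Fin.natAdd j i)
      simp only [hGr] at this
      have h2 : fderiv ℝ (fun x => b i x) x₀ = LinearMap.toContinuousLinearMap (b i) :=
        (LinearMap.toContinuousLinearMap (b i)).fderiv
      rw [h2] at this
      exact this)
  obtain ⟨t, htf, hts⟩ := exists_perm j (fun i => if h : i < j then s ⟨i, h⟩ else 0) (by
    intro a ha b hb hab
    have ha : a < j := ha
    have hb : b < j := hb
    simp only [ha, hb, dif_pos] at hab
    simpa using hs hab)
  let Ψ : LpInfty → LpInfty := fun x => ⟨fun i => x (t i), by
    refine memℓp_infty ⟨‖x‖, ?_⟩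
    rintro _ ⟨i, rfl⟩
    exact lp.norm_apply_le_norm (by simp) x (t i)⟩
  refine ⟨U, K ∩ T ∩ N ∩ U, G, Ginv, Ψ, ?_, ?_, hdf, ⟨t, htf, fun x i => rfl⟩, ?_⟩
  · exact fun x hx => ⟨(hKB hx.1.1.1).1, hx.2⟩
  · exact hpos _ (inter_mem self_mem_nhdsWithin (mem_nhdsWithin_of_mem_nhds (hdf.1.mem_nhds hxU)))
  · rintro _ ⟨y, hy, rfl⟩ i hi
    rw [hdf.2.2.1 y hy.2]
    change f y (t i) = G y i
    have h2 : G y i = g y ⟨i, hi⟩ := hGl y ⟨i, hi⟩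
    rw [h2, hts i hi, dif_pos hi, hfF (hKB hy.1.1.1).1]
    exact congrFun (hgK y hy.1.1.1) ⟨i, hi⟩

end
end

section
/- Let g = (g₁,g₂,…) : ℝ^k → ℝ^ℕ be a map each of whose components g_i is of class C¹, let x₀ ∈ ℝ^k, and suppose the component-wise derivative Dg(x₀) (the ∞×k matrix with rows Dg_i(x₀)) has rank at least j. Then there exist a neighborhood U of x₀, a bi-Lipschitz C¹-diffeomorphism G : U → G(U) ⊂ ℝ^k, and a permutation Ψ of finitely many coordinates of ℝ^ℕ, such that (Ψ∘g∘G⁻¹)_i(x) = x_i for i = 1,…,j and all x ∈ G(U). -/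
open MeasureTheory Metric Set Filter
open scoped ENNReal NNReal Topology

noncomputable section

lemma aux_perm (τ : ℕ → ℕ) (j : ℕ) (hτ : ∀ a < j, ∀ b < j, τ a = τ b → a = b) :
    ∃ σ : Equiv.Perm ℕ, {i | σ i ≠ i}.Finite ∧ ∀ i < j, σ i = τ i := by
  induction j with
  | zero => exact ⟨1, by simp, by simp⟩
  | succ j ih =>
    obtain ⟨σ, hf, hσ⟩ := ih fun a ha b hb => hτ a (by omega) b (by omega)
    refine ⟨Equiv.swap (σ j) (τ j) * σ, ?_, ?_⟩
    · refine (hf.union (Set.toFinite ({σ.symm (σ j), σ.symm (τ j)} : Set ℕ))).subset ?_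
      intro i hi
      by_contra hcon
      simp only [Set.mem_union, Set.mem_ofPred_eq, Set.mem_insert_iff, Set.mem_singleton_iff,
        not_or, not_not, Equiv.eq_symm_apply] at hcon
      obtain ⟨h1, h2, h3⟩ := hcon
      apply hi
      rw [Equiv.Perm.mul_apply, Equiv.swap_apply_of_ne_of_ne _ h3, h1]
      intro h; exact h2 (by rw [← h])
    · intro i hi
      rcases Nat.lt_succ_iff_lt_or_eq.1 hi with h | h
      · rw [Equiv.Perm.mul_apply, Equiv.swap_apply_of_ne_of_ne, hσ i h]
        · intro h'
          have := σ.injective h'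
          omega
        · rw [hσ i h]
          intro h'
          have := hτ i hi j (by omega) h'
          omega
      · subst h; simp

lemma aux_extend {V : Type*} [AddCommGroup V] [Module ℝ V] [FiniteDimensional ℝ V]
    (w : ℕ → V) (j d : ℕ) (hd : j + d ≤ Module.finrank ℝ V)
    (hw : LinearIndependent ℝ (fun i : Fin j => w i)) :
    ∃ w' : ℕ → V, (∀ i < j, w' i = w i) ∧
      LinearIndependent ℝ (fun i : Fin (j + d) => w' i) := by
  induction d with
  | zero => exact ⟨w, fun _ _ => rfl, hw⟩
  | succ d ih =>
    obtain ⟨w', h1, h2⟩ := ih (by omega)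
    obtain ⟨x, hx⟩ := exists_linearIndependent_snoc_of_lt_finrank h2 (by omega)
    refine ⟨Function.update w' (j + d) x, ?_, ?_⟩
    · intro i hi
      rw [Function.update_of_ne (by omega), h1 i hi]
    · have hfun : (fun i : Fin (j + d + 1) => Function.update w' (j + d) x i)
          = Fin.snoc (fun i : Fin (j + d) => w' i) x := ?_
      · rw [← hfun] at hx
        exact hx
      funext i
      refine Fin.lastCases ?_ (fun i => ?_) i
      · simp
      · have : (i : ℕ) ≠ j + d := by omega
        simp [Function.update_of_ne this]

lemma aux_select {V : Type*} [AddCommGroup V] [Module ℝ V] [FiniteDimensional ℝ V]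
    (L : ℕ → Module.Dual ℝ V) (j : ℕ)
    (hrank : (j : Cardinal) ≤ LinearMap.rank (LinearMap.pi L)) :
    j ≤ Module.finrank ℝ V ∧ ∃ τ : ℕ → ℕ, LinearIndependent ℝ (fun i : Fin j => L (τ i)) := by
  have h1 : j ≤ Module.finrank ℝ (LinearMap.range (LinearMap.pi L)) := by
    have h : LinearMap.rank (LinearMap.pi L)
      = (Module.finrank ℝ (LinearMap.range (LinearMap.pi L)) : Cardinal) :=
      (Module.finrank_eq_rank ℝ (LinearMap.range (LinearMap.pi L))).symm
    rw [h] at hrank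
    exact_mod_cast hrank
  have h2 := LinearMap.finrank_range_add_finrank_ker (LinearMap.pi L)
  have h3 := Subspace.finrank_add_finrank_dualCoannihilator_eq (Submodule.span ℝ (Set.range L))
  have h4 : (Submodule.span ℝ (Set.range L)).dualCoannihilator = LinearMap.ker (LinearMap.pi L) := by
    ext x
    rw [Submodule.mem_dualCoannihilator, LinearMap.mem_ker]
    constructor
    · intro h
      funext i
      exact h (L i) (Submodule.subset_span ⟨i, rfl⟩)
    · intro h φ hφ
      induction hφ using Submodule.span_induction with
      | mem y hy => obtain ⟨i, rfl⟩ := hy; exact congrFun h i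
      | zero => simp
      | add a b _ _ ha hb => simp [ha, hb]
      | smul a b _ hb => simp [hb]
  rw [h4] at h3
  refine ⟨by omega, ?_⟩
  obtain ⟨f, hf, -, hli⟩ := Submodule.exists_fun_fin_finrank_span_eq ℝ (Set.range L)
  choose t ht using hf
  have hj : j ≤ Module.finrank ℝ (Submodule.span ℝ (Set.range L)) := by omega
  refine ⟨fun i => if h : i < j then t ⟨i, by omega⟩ else 0, ?_⟩
  have := hli.comp (Fin.castLE hj) (Fin.castLE_injective hj)
  have hfun : (fun i : Fin j => L (if h : (i : ℕ) < j then t ⟨i, by omega⟩ else 0))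
      = f ∘ Fin.castLE hj := by
    funext i
    simp [ht, Fin.castLE]
  rw [← hfun] at this
  exact this

lemma aux_inverse {k : ℕ} (G : EucSp k → EucSp k) (x₀ : EucSp k) (hG : ContDiff ℝ 1 G)
    (A : EucSp k ≃L[ℝ] EucSp k) (hA : HasFDerivAt G (A : EucSp k →L[ℝ] EucSp k) x₀) :
    ∃ (U : Set (EucSp k)) (Ginv : EucSp k → EucSp k), x₀ ∈ U ∧ IsBiLipC1DiffeoOn G Ginv U := by
  have hGa : ContDiffAt ℝ 1 G x₀ := hG.contDiffAt
  set e := hGa.toOpenPartialHomeomorph G hA one_ne_zero with he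
  have hx0 : x₀ ∈ e.source := hGa.mem_toOpenPartialHomeomorph_source hA one_ne_zero
  have hinv : ContDiffAt ℝ 1 e.symm (G x₀) := hGa.to_localInverse hA one_ne_zero
  have hcoe : ∀ x, e x = G x := fun _ => rfl
  obtain ⟨K₁, s, hs, hK₁⟩ := hGa.exists_lipschitzOnWith
  obtain ⟨K₂, t, ht, hK₂⟩ := hinv.exists_lipschitzOnWith
  have hev := hinv.eventually (by simp)
  obtain ⟨t', ht', ht'o, ht'm⟩ := _root_.mem_nhds_iff.1 (Filter.inter_mem ht hev)
  obtain ⟨s', hs', hs'o, hs'm⟩ := _root_.mem_nhds_iff.1 hs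
  have hsub : G '' (e.source ∩ (s' ∩ G ⁻¹' t')) ⊆ t' := by
    rintro _ ⟨x, hx, rfl⟩; exact hx.2.2
  have hUo : IsOpen (s' ∩ G ⁻¹' t') := hs'o.inter (ht'o.preimage hG.continuous)
  refine ⟨e.source ∩ (s' ∩ G ⁻¹' t'), e.symm, ⟨hx0, hs'm, ht'm⟩, e.open_source.inter hUo,
    e.isOpen_image_source_inter hUo, ?_, ?_, hG.contDiffOn, ?_, max K₁ K₂, ?_, ?_⟩
  · intro x hx; exact e.left_inv hx.1
  · rintro _ ⟨x, hx, rfl⟩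
    rw [← hcoe x, e.left_inv hx.1, hcoe]
  · intro y hy
    have h : ContDiffAt ℝ 1 e.symm y := (ht' (hsub hy)).2
    exact h.contDiffWithinAt
  · exact (hK₁.mono fun x hx => hs' hx.2.1).weaken (le_max_left _ _)
  · exact (hK₂.mono fun x hx => (ht' (hsub hx)).1).weaken (le_max_right _ _)

/-- inner lemma of Lemma 3.1: if `g : ℝ^k → ℝ^ℕ` has `C¹` components
and the component-wise derivative at `x₀` has rank `≥ j`, then there are a neighborhood
`U` of `x₀`, a bi-Lipschitz `C¹`-diffeomorphism `G : U → G(U)` and a permutation `σ` of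
finitely many coordinates of `ℝ^ℕ` such that `(Ψ ∘ g ∘ G⁻¹)ᵢ(x) = xᵢ` for `i = 1,…,j`
and all `x ∈ G(U)`, where `(Ψ v) i = v (σ i)`. -/
theorem stmt6 {k j : ℕ} (g : EucSp k → (ℕ → ℝ)) (x₀ : EucSp k)
    (hg : ∀ i : ℕ, ContDiff ℝ 1 (fun x => g x i))
    (hrank : (j : Cardinal) ≤ LinearMap.rank
      (LinearMap.pi (fun i : ℕ => (fderiv ℝ (fun x => g x i) x₀).toLinearMap))) :
    ∃ (U : Set (EucSp k)) (G Ginv : EucSp k → EucSp k) (σ : Equiv.Perm ℕ),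
      x₀ ∈ U ∧ IsBiLipC1DiffeoOn G Ginv U ∧ {i | σ i ≠ i}.Finite ∧
      ∀ x ∈ G '' U, ∀ i : Fin k, (i : ℕ) < j → g (Ginv x) (σ (i : ℕ)) = x i := by
  obtain ⟨hjk, τ, hτ⟩ := aux_select _ j hrank
  rw [finrank_euclideanSpace_fin] at hjk
  set L : ℕ → Module.Dual ℝ (EucSp k) :=
    fun i => (fderiv ℝ (fun x => g x i) x₀).toLinearMap with hL
  obtain ⟨σ, hfin, hσ⟩ := aux_perm τ j (by
    intro a ha b hb hab
    have := hτ.injective (a₁ := ⟨a, ha⟩) (a₂ := ⟨b, hb⟩) (by simp only [hab])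
    simpa using this)
  obtain ⟨w, hw, hwli⟩ := aux_extend (fun i => L (τ i)) j (k - j) (by
    rw [Subspace.dual_finrank_eq, finrank_euclideanSpace_fin]; omega) hτ
  have hk : j + (k - j) = k := by omega
  rw [hk] at hwli
  have hspan := hwli.span_eq_top_of_card_eq_finrank' (by
    rw [Subspace.dual_finrank_eq, finrank_euclideanSpace_fin, Fintype.card_fin])
  let A₀ : EucSp k →ₗ[ℝ] EucSp k :=
    (WithLp.linearEquiv 2 ℝ (Fin k → ℝ)).symm.toLinearMap.comp
      (LinearMap.pi (fun i : Fin k => w i))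
  have hA₀ : ∀ x i, A₀ x i = w i x := fun _ _ => rfl
  have hinj : Function.Injective A₀ := by
    rw [← LinearMap.ker_eq_bot, LinearMap.ker_eq_bot']
    intro x hx
    rw [← Module.forall_dual_apply_eq_zero_iff ℝ]
    intro φ
    have hφ : φ ∈ Submodule.span ℝ (Set.range fun i : Fin k => w i) := hspan ▸ Submodule.mem_top
    induction hφ using Submodule.span_induction with
    | mem y hy => obtain ⟨i, rfl⟩ := hy; rw [← hA₀ x i, hx]; rfl
    | zero => simp
    | add a b _ _ ha hb => simp [ha, hb]
    | smul a b _ hb => simp [hb]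
  let A : EucSp k ≃L[ℝ] EucSp k := (LinearEquiv.ofInjectiveEndo A₀ hinj).toContinuousLinearEquiv
  have hA : ∀ x i, A x i = w i x := fun _ _ => rfl
  let G : EucSp k → EucSp k := fun x =>
    WithLp.toLp 2 (fun i : Fin k => if (i : ℕ) < j then g x (σ i) else w i x)
  have hGc : ContDiff ℝ 1 G := by
    rw [contDiff_euclidean]
    intro i
    by_cases hi : (i : ℕ) < j
    · simpa [G, hi] using hg (σ i)
    · simpa [G, hi] using (LinearMap.toContinuousLinearMap (w i)).contDiff
  have hGd : HasFDerivAt G (A : EucSp k →L[ℝ] EucSp k) x₀ := by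
    rw [← hasFDerivWithinAt_univ, hasFDerivWithinAt_euclidean]
    intro i
    rw [hasFDerivWithinAt_univ]
    by_cases hi : (i : ℕ) < j
    · have h := ((hg (σ i)).differentiable one_ne_zero x₀).hasFDerivAt
      have hE : (EuclideanSpace.proj i : EucSp k →L[ℝ] ℝ).comp (A : EucSp k →L[ℝ] EucSp k)
          = fderiv ℝ (fun x => g x (σ i)) x₀ := by
        ext1 x
        change w i x = _
        rw [hw i hi, hσ i hi]
        rfl
      rw [← hE] at h
      simpa [G, hi] using h
    · have h := (LinearMap.toContinuousLinearMap (w i)).hasFDerivAt (x := x₀)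
      have hE : (EuclideanSpace.proj i : EucSp k →L[ℝ] ℝ).comp (A : EucSp k →L[ℝ] EucSp k)
          = LinearMap.toContinuousLinearMap (w i) := by
        ext1 x
        rfl
      rw [← hE] at h
      simpa [G, hi] using! h
  obtain ⟨U, Ginv, hU, hdiff⟩ := aux_inverse G x₀ hGc A hGd
  refine ⟨U, G, Ginv, σ, hU, hdiff, hfin, ?_⟩
  rintro _ ⟨x, hx, rfl⟩ i hi
  rw [hdiff.2.2.1 x hx]
  simp [G, hi]

end
end

section
/- Let A ⊂ ℝ^k be a measurable set, n ≤ k, and f : A → ℓ^∞ a Lipschitz map. If the upper n-density Θ^{*n}(f,x) > 0 on a subset of A of positive Lebesgue measure, then the rank of the component-wise approximate derivative ap Df(x) is at least n on a set of positive Lebesgue measure. -/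
open MeasureTheory Metric Set Filter
open scoped ENNReal NNReal Topology

noncomputable section

/-- Averaged fundamental-theorem estimate for a Lipschitz function along a direction `v`. -/
lemma key_comp {k : ℕ} {L : ℝ≥0} {h : EucSp k → ℝ} (hh : LipschitzWith L h)
    {g : EucSp k → ℝ} {v : EucSp k} (hg : ∀ y, |fderiv ℝ h y v| ≤ g y)
    (hgi : LocallyIntegrable g volume) (x y : EucSp k) {r ρ R : ℝ} (hr : 0 ≤ r) (hρ : 0 ≤ ρ)
    (hR : ρ + ‖y - x‖ + r * ‖v‖ ≤ R) :
    volume.real (closedBall (0 : EucSp k) ρ) * |h (y + r • v) - h y| ≤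
      2 * L * ρ * volume.real (closedBall (0 : EucSp k) ρ) + r * ∫ z in closedBall x R, g z := by
  have hg0 : ∀ y, 0 ≤ g y := fun y => (abs_nonneg _).trans (hg y)
  set B := closedBall (0 : EucSp k) ρ with hB
  have hBm : MeasurableSet B := measurableSet_closedBall
  have hBc : IsCompact B := isCompact_closedBall _ _
  have hBfin : volume B ≠ ∞ := hBc.measure_lt_top.ne
  have hcont : Continuous h := hh.continuous
  have hint : ∀ c : EucSp k, IntegrableOn (fun u => h (c + u)) B volume := fun c =>
    (hcont.comp (continuous_const.add continuous_id)).continuousOn.integrableOn_compact hBc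
  have hder : ∀ t : ℝ, HasDerivAt (fun t : ℝ => ∫ u in B, h (y + t • v + u))
      (∫ u in B, fderiv ℝ h (y + t • v + u) v) t := by
    intro t
    refine (hasDerivAt_integral_of_dominated_loc_of_lip (s := univ)
      (F := fun t u => h (y + t • v + u)) (bound := fun _ => (L : ℝ) * ‖v‖) (μ := volume.restrict B)
      (x₀ := t) univ_mem ?_ (hint (y + t • v)) ?_ ?_ ?_ ?_).2
    · exact Eventually.of_forall fun s => (hint _).aestronglyMeasurable
    · refine Measurable.aestronglyMeasurable ?_
      exact (measurable_fderiv_apply_const ℝ h v).comp (measurable_const_add _)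
    · refine Eventually.of_forall fun u => LipschitzOnWith.of_dist_le_mul ?_
      intro a _ b _
      refine (hh.dist_le_mul _ _).trans ?_
      have : dist (y + a • v + u) (y + b • v + u) = ‖v‖ * dist a b := by
        rw [dist_add_right, dist_add_left, dist_eq_norm, ← sub_smul, norm_smul, mul_comm,
          dist_eq_norm]
      rw [this]
      simp [mul_assoc]
    · exact integrableOn_const hBfin
    · have h1 : ∀ᵐ z ∂(volume : Measure (EucSp k)), DifferentiableAt ℝ h z :=
        hh.ae_differentiableAt
      have h2 : ∀ᵐ u ∂(volume : Measure (EucSp k)), DifferentiableAt ℝ h (y + t • v + u) :=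
        (measurePreserving_add_left volume (y + t • v)).quasiMeasurePreserving.ae h1
      refine ae_restrict_of_ae ?_
      filter_upwards [h2] with u hu
      have h3 : HasDerivAt (fun t : ℝ => y + t • v + u) v t := by
        have := (((hasDerivAt_id t).smul_const v).const_add y).add_const u
        simpa using this
      exact hu.hasFDerivAt.comp_hasDerivAt t h3
  have hbound : ∀ t ∈ Ico 0 r, ‖∫ u in B, fderiv ℝ h (y + t • v + u) v‖
      ≤ ∫ z in closedBall x R, g z := by
    intro t ht
    set c := y + t • v with hc
    have hsub : B ⊆ (fun u => c + u) ⁻¹' closedBall x R := by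
      intro u hu
      simp only [hB, mem_closedBall, dist_zero_right] at hu
      simp only [mem_preimage, mem_closedBall, dist_eq_norm]
      have e : c + u - x = u + (y - x) + t • v := by rw [hc]; abel
      rw [e]
      refine (norm_add₃_le).trans ?_
      rw [norm_smul, Real.norm_of_nonneg ht.1]
      have : t * ‖v‖ ≤ r * ‖v‖ := by gcongr; exact ht.2.le
      linarith
    have hgR : IntegrableOn g (closedBall x R) volume :=
      hgi.integrableOn_isCompact (isCompact_closedBall _ _)
    have mp := measurePreserving_add_left (volume : Measure (EucSp k)) c
    have me : MeasurableEmbedding (fun u : EucSp k => c + u) := measurableEmbedding_addLeft c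
    have hgc : IntegrableOn (fun u => g (c + u)) ((fun u => c + u) ⁻¹' closedBall x R) volume :=
      (mp.integrableOn_comp_preimage me).2 hgR
    calc ‖∫ u in B, fderiv ℝ h (c + u) v‖ ≤ ∫ u in B, g (c + u) := by
          refine norm_integral_le_of_norm_le (hgc.mono_set hsub) ?_
          exact Eventually.of_forall fun u => hg _
      _ ≤ ∫ u in (fun u => c + u) ⁻¹' closedBall x R, g (c + u) := by
          refine setIntegral_mono_set hgc ?_ (LE.le.eventuallyLE hsub)
          exact Eventually.of_forall fun u => hg0 _
      _ = _ := mp.setIntegral_preimage_emb me g _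
  have hmv := norm_image_sub_le_of_norm_deriv_le_segment' (a := 0) (b := r)
    (fun t _ => (hder t).hasDerivWithinAt) hbound r ⟨hr, le_rfl⟩
  have hconst : ∀ c : EucSp k, ‖(∫ u in B, h (c + u)) - volume.real B * h c‖ ≤
      L * ρ * volume.real B := by
    intro c
    have : (∫ u in B, h (c + u)) - volume.real B * h c = ∫ u in B, (h (c + u) - h c) := by
      rw [integral_sub (hint c) (integrableOn_const hBfin)]
      simp
    rw [this]
    refine norm_setIntegral_le_of_norm_le_const hBc.measure_lt_top ?_
    intro u hu
    rw [← dist_eq_norm]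
    refine (hh.dist_le_mul _ _).trans ?_
    simp only [hB, mem_closedBall, dist_zero_right] at hu
    rw [dist_eq_norm, add_sub_cancel_left]
    gcongr
  have h1 := hconst (y + r • v)
  have h2 := hconst y
  simp only [zero_smul, add_zero, sub_zero, Real.norm_eq_abs] at hmv h1 h2
  have hV : 0 ≤ volume.real B := measureReal_nonneg
  rw [← abs_of_nonneg hV, ← abs_mul, abs_of_nonneg hV, mul_sub]
  rw [abs_le] at *
  constructor <;> linarith [h1.1, h1.2, h2.1, h2.2, hmv.1, hmv.2]

lemma lip_comp {k : ℕ} {L : ℝ≥0} {F : EucSp k → LpInfty} (hF : LipschitzWith L F) (i : ℕ) :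
    LipschitzWith L (fun z => F z i) := by
  refine LipschitzWith.of_dist_le_mul fun a b => ?_
  refine le_trans ?_ (hF.dist_le_mul a b)
  rw [dist_eq_norm, dist_eq_norm]
  exact lp.norm_apply_le_norm (by simp) (F a - F b) i

lemma abs_fderiv_le {k : ℕ} {L : ℝ≥0} {F : EucSp k → LpInfty} (hF : LipschitzWith L F) (i : ℕ)
    (x v : EucSp k) : |fderiv ℝ (fun z => F z i) x v| ≤ L * ‖v‖ := by
  refine ((fderiv ℝ (fun z => F z i) x).le_opNorm v).trans ?_
  gcongr
  exact norm_fderiv_le_of_lipschitz ℝ (lip_comp hF i)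

/-- The supremum over all components of the directional derivative in direction `v`. -/
def gdir {k : ℕ} (F : EucSp k → LpInfty) (v y : EucSp k) : ℝ :=
  ⨆ i : ℕ, |fderiv ℝ (fun z => F z i) y v|

lemma le_gdir {k : ℕ} {L : ℝ≥0} {F : EucSp k → LpInfty} (hF : LipschitzWith L F) (i : ℕ)
    (x v : EucSp k) : |fderiv ℝ (fun z => F z i) x v| ≤ gdir F v x :=
  le_ciSup (f := fun i : ℕ => |fderiv ℝ (fun z => F z i) x v|)
    ⟨L * ‖v‖, by rintro _ ⟨j, rfl⟩; exact abs_fderiv_le hF j x v⟩ i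

lemma gdir_nonneg {k : ℕ} {L : ℝ≥0} {F : EucSp k → LpInfty} (hF : LipschitzWith L F)
    (x v : EucSp k) : 0 ≤ gdir F v x := (abs_nonneg _).trans (le_gdir hF 0 x v)

lemma gdir_locInt {k : ℕ} {L : ℝ≥0} {F : EucSp k → LpInfty} (hF : LipschitzWith L F)
    (v : EucSp k) : LocallyIntegrable (gdir F v) volume := by
  have hm : Measurable (gdir F v) :=
    Measurable.iSup fun i => (measurable_fderiv_apply_const ℝ (fun z => F z i) v).abs
  refine (locallyIntegrable_const ((L : ℝ) * ‖v‖)).mono hm.aestronglyMeasurable ?_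
  refine Eventually.of_forall fun x => ?_
  rw [Real.norm_of_nonneg (gdir_nonneg hF x v), Real.norm_of_nonneg (by positivity)]
  exact ciSup_le fun i => abs_fderiv_le hF i x v

lemma small_dir {k : ℕ} {L : ℝ≥0} {F : EucSp k → LpInfty} (hF : LipschitzWith L F)
    {η : ℝ} (hη : 0 < η) : ∃ c > 0, ∀ (x v : EucSp k), ‖v‖ ≤ 3 →
      Tendsto (fun ρ => ⨍ z in closedBall x ρ, gdir F v z) (𝓝[>] 0) (𝓝 (gdir F v x)) →
      gdir F v x < c → ∀ᶠ r : ℝ in 𝓝[>] 0, ∀ y, ‖y - x‖ ≤ r → ‖F (y + r • v) - F y‖ ≤ η * r := by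
  set δ : ℝ := min 1 (η / (4 * (L + 1))) with hδ
  have hL : (0 : ℝ) ≤ L := L.2
  have hδ0 : 0 < δ := lt_min one_pos (by positivity)
  have hδ1 : δ ≤ 1 := min_le_left _ _
  have hδ2 : 2 * L * δ ≤ η / 2 := by
    have h1 : δ ≤ η / (4 * (L + 1)) := min_le_right _ _
    rw [le_div_iff₀ (by positivity)] at h1
    nlinarith
  refine ⟨(η / 2) / (5 / δ) ^ k, by positivity, ?_⟩
  intro x v hv hlim hsmall
  have h5 : Tendsto (fun r : ℝ => 5 * r) (𝓝[>] 0) (𝓝[>] 0) := by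
    refine tendsto_nhdsWithin_iff.2 ⟨?_, ?_⟩
    · have : Tendsto (fun r : ℝ => 5 * r) (𝓝 0) (𝓝 (5 * 0)) := tendsto_id.const_mul 5
      rw [mul_zero] at this
      exact this.mono_left nhdsWithin_le_nhds
    · filter_upwards [self_mem_nhdsWithin] with r hr
      have : (0 : ℝ) < r := hr
      simp [this]
  have hev := (hlim.comp h5).eventually (gt_mem_nhds hsmall)
  filter_upwards [hev, self_mem_nhdsWithin] with r hr hr0 y hy
  replace hr0 : (0 : ℝ) < r := hr0
  refine lp.norm_le_of_forall_le (by positivity) fun i => ?_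
  have hk := key_comp (lip_comp hF i) (fun y => le_gdir hF i y v) (gdir_locInt hF v) x y
    (r := r) (ρ := δ * r) (R := 5 * r) hr0.le (by positivity) (by nlinarith)
  simp only [Function.comp] at hr
  rw [setAverage_eq, smul_eq_mul, Measure.addHaar_real_closedBall _ _ (by positivity)] at hr
  rw [Measure.addHaar_real_closedBall _ _ (by positivity)] at hk
  have hV : 0 < volume.real (ball (0 : EucSp k) 1) := by
    rw [measureReal_def, ENNReal.toReal_pos_iff]
    exact ⟨measure_ball_pos _ _ one_pos, measure_ball_lt_top⟩
  simp only [finrank_euclideanSpace, Fintype.card_fin] at hr hk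
  set V := volume.real (ball (0 : EucSp k) 1)
  set I := ∫ z in closedBall x (5 * r), gdir F v z
  have hI : I < (η / 2) * ((δ * r) ^ k * V) := by
    rw [inv_mul_lt_iff₀ (by positivity)] at hr
    refine hr.trans_eq ?_
    rw [mul_pow, mul_pow, div_pow]
    field_simp
  have hgoal : |F (y + r • v) i - F y i| ≤ η * r := by
    have hP : 0 < (δ * r) ^ k * V := by positivity
    refine le_of_mul_le_mul_left ?_ hP
    refine hk.trans ?_
    have h1 : r * I ≤ r * ((η / 2) * ((δ * r) ^ k * V)) := by gcongr
    have h2 : 2 * L * (δ * r) * ((δ * r) ^ k * V) ≤ (η / 2) * r * ((δ * r) ^ k * V) := by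
      have : 2 * L * (δ * r) ≤ (η / 2) * r := by nlinarith
      gcongr
    linarith
  simpa using hgoal

lemma small_ker {k : ℕ} {L : ℝ≥0} {F : EucSp k → LpInfty} (hF : LipschitzWith L F)
    {T : Set (EucSp k)} (hT : Dense T) {x : EucSp k}
    (hx : ∀ v ∈ T, Tendsto (fun ρ => ⨍ z in closedBall x ρ, gdir F v z) (𝓝[>] 0)
      (𝓝 (gdir F v x)))
    (W : Submodule ℝ (EucSp k)) (hW : ∀ w ∈ W, ∀ i : ℕ, fderiv ℝ (fun z => F z i) x w = 0)
    {η : ℝ} (hη : 0 < η) : ∀ᶠ r : ℝ in 𝓝[>] 0, ∀ y, ‖y - x‖ ≤ r → ∀ w ∈ W, ‖w‖ ≤ 2 * r →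
      ‖F (y + w) - F y‖ ≤ η * r := by
  obtain ⟨c, hc, hsm⟩ := small_dir hF (half_pos hη)
  have hL : (0 : ℝ) ≤ L := L.2
  set ε : ℝ := min 1 (min (η / 2 / (L + 1)) (c / (L + 1))) with hε
  have hε0 : 0 < ε := lt_min one_pos (lt_min (by positivity) (by positivity))
  have hε1 : ε ≤ 1 := min_le_left _ _
  have hε2 : L * ε ≤ η / 2 := by
    have h1 : ε ≤ η / 2 / (L + 1) := (min_le_right _ _).trans (min_le_left _ _)
    rw [le_div_iff₀ (by positivity)] at h1
    nlinarith
  have hε3 : L * ε < c := by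
    have h1 : ε ≤ c / (L + 1) := (min_le_right _ _).trans (min_le_right _ _)
    rw [le_div_iff₀ (by positivity)] at h1
    nlinarith
  have hK : IsCompact ((W : Set (EucSp k)) ∩ closedBall 0 2) :=
    (isCompact_closedBall _ _).inter_left W.closed_of_finiteDimensional
  choose p hpT hp using fun w : EucSp k => hT.exists_dist_lt w hε0
  obtain ⟨t, htK, hcov⟩ := hK.elim_nhds_subcover (fun w => ball (p w) ε)
    (fun w _ => isOpen_ball.mem_nhds (hp w))
  have hall : ∀ᶠ r : ℝ in 𝓝[>] 0, ∀ w ∈ t, ∀ y, ‖y - x‖ ≤ r →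
      ‖F (y + r • p w) - F y‖ ≤ η / 2 * r := by
    rw [Filter.eventually_all_finset]
    intro w hw
    have hwK := htK w hw
    have hd : ‖p w - w‖ < ε := by rw [← dist_eq_norm, dist_comm]; exact hp w
    refine hsm x (p w) ?_ (hx _ (hpT w)) ?_
    · have h2 : ‖w‖ ≤ 2 := by simpa using hwK.2
      have : ‖p w‖ ≤ ‖p w - w‖ + ‖w‖ := by simpa using norm_add_le (p w - w) w
      linarith
    · refine lt_of_le_of_lt (ciSup_le fun i => ?_) hε3
      have : fderiv ℝ (fun z => F z i) x (p w) = fderiv ℝ (fun z => F z i) x (p w - w) := by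
        rw [map_sub, hW w hwK.1 i, sub_zero]
      rw [this]
      refine (abs_fderiv_le hF i x _).trans ?_
      gcongr
  filter_upwards [hall, self_mem_nhdsWithin] with r hr hr0 y hy w hw hwr
  replace hr0 : (0 : ℝ) < r := hr0
  have hmem : r⁻¹ • w ∈ (W : Set (EucSp k)) ∩ closedBall 0 2 := by
    refine ⟨W.smul_mem _ hw, ?_⟩
    rw [mem_closedBall, dist_zero_right, norm_smul, norm_inv, Real.norm_of_nonneg hr0.le,
      inv_mul_le_iff₀ hr0]
    linarith
  obtain ⟨w0, hw0, hw0'⟩ := mem_iUnion₂.1 (hcov hmem)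
  have h1 := hr w0 hw0 y hy
  have h2 : ‖F (y + w) - F (y + r • p w0)‖ ≤ L * (r * ε) := by
    rw [← dist_eq_norm]
    refine (hF.dist_le_mul _ _).trans ?_
    gcongr
    rw [dist_add_left]
    have e : w = r • (r⁻¹ • w) := by rw [smul_inv_smul₀ hr0.ne']
    rw [e, dist_smul₀, Real.norm_of_nonneg hr0.le]
    gcongr
    exact (mem_ball.1 hw0').le
  have h3 := norm_sub_le_norm_sub_add_norm_sub (F (y + w)) (F (y + r • p w0)) (F y)
  have h4 : L * (r * ε) ≤ η / 2 * r := by nlinarith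
  linarith

lemma hContent_le {X : Type*} [PseudoEMetricSpace X] {n : ℕ} (hn : n ≠ 0) {E : Set X}
    {ι : Type*} [Fintype ι] (S : ι → Set X) (hS : E ⊆ ⋃ i, S i) {d : ℝ≥0∞}
    (hd : ∀ i, Metric.ediam (S i) ≤ d) :
    hContent n E ≤ unitBallVol n / 2 ^ n * (Fintype.card ι * d ^ n) := by
  classical
  let e := Fintype.equivFin ι
  let S' : ℕ → Set X := fun j => if h : j < Fintype.card ι then S (e.symm ⟨j, h⟩) else ∅
  have hcov : E ⊆ ⋃ j, S' j := by
    intro z hz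
    obtain ⟨i, hi⟩ := mem_iUnion.1 (hS hz)
    refine mem_iUnion.2 ⟨e i, ?_⟩
    simp only [S', (e i).2, dif_pos, Fin.eta, Equiv.symm_apply_apply]
    exact hi
  refine (iInf₂_le S' hcov).trans ?_
  gcongr
  rw [tsum_eq_sum (s := Finset.range (Fintype.card ι))]
  · calc _ ≤ ∑ j ∈ Finset.range (Fintype.card ι), d ^ n := by
          refine Finset.sum_le_sum fun j hj => ?_
          gcongr
          simp only [S', dif_pos (Finset.mem_range.1 hj)]
          exact hd _
      _ = _ := by simp
  · intro j hj
    simp only [S', dif_neg (fun h => hj (Finset.mem_range.2 h))]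
    simp only [ne_eq, hn, not_false_eq_true, pow_eq_zero_iff]
    exact Metric.ediam_empty

/-- The component-wise derivative as a linear map into `ℕ → ℝ`. -/
def compD {k : ℕ} (F : EucSp k → LpInfty) (x : EucSp k) : EucSp k →ₗ[ℝ] (ℕ → ℝ) :=
  LinearMap.pi fun i => (fderiv ℝ (fun z => F z i) x : EucSp k →ₗ[ℝ] ℝ)

lemma real_bound {m n M : ℕ} (hmn : m < n) (hM : 1 ≤ M) {C r : ℝ} (hC : 0 ≤ C) (hr : 0 < r) :
    ((2 * M + 1 : ℝ)) ^ m * (C * r / M) ^ n ≤ (3 * C) ^ n / M * r ^ n := by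
  have hM' : (1 : ℝ) ≤ M := by exact_mod_cast hM
  obtain ⟨p, rfl⟩ : ∃ p, n = p + 1 := ⟨n - 1, by omega⟩
  have h1 : ((2 * M + 1 : ℝ)) ^ m ≤ (3 * M) ^ p := by
    calc ((2 * M + 1 : ℝ)) ^ m ≤ (3 * M) ^ m := by gcongr; linarith
      _ ≤ (3 * M) ^ p := pow_le_pow_right₀ (by linarith) (by omega)
  have h2 : (3 * M : ℝ) ^ p ≤ 3 ^ (p + 1) * M ^ p := by
    rw [mul_pow, pow_succ]
    have : (0 : ℝ) ≤ 3 ^ p * M ^ p := by positivity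
    nlinarith
  calc ((2 * M + 1 : ℝ)) ^ m * (C * r / M) ^ (p + 1)
      ≤ (3 ^ (p + 1) * M ^ p) * (C * r / M) ^ (p + 1) := by gcongr; exact h1.trans h2
    _ = _ := by
      rw [div_pow, mul_pow, mul_pow, pow_succ (M : ℝ) p]
      field_simp

lemma upperDensity_zero {k n : ℕ} {L : ℝ≥0} {F : EucSp k → LpInfty} (hF : LipschitzWith L F)
    {T : Set (EucSp k)} (hT : Dense T) {x : EucSp k}
    (hx : ∀ v ∈ T, Tendsto (fun ρ => ⨍ z in closedBall x ρ, gdir F v z) (𝓝[>] 0)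
      (𝓝 (gdir F v x)))
    (hrank : Module.finrank ℝ (LinearMap.range (compD F x)) < n)
    {f : EucSp k → LpInfty} {A : Set (EucSp k)} (hfF : EqOn f F A) :
    upperDensity n f A x = 0 := by
  set W := LinearMap.ker (compD F x) with hWdef
  have hW : ∀ w ∈ W, ∀ i : ℕ, fderiv ℝ (fun z => F z i) x w = 0 := by
    intro w hw i
    exact congrFun (LinearMap.mem_ker.1 hw) i
  have hL : (0 : ℝ) ≤ L := L.2
  have hm : Module.finrank ℝ Wᗮ < n := by
    have h1 := W.finrank_add_finrank_orthogonal
    have h2 := (compD F x).finrank_range_add_finrank_ker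
    rw [← hWdef] at h2
    omega
  set m := Module.finrank ℝ Wᗮ with hmdef
  let b := stdOrthonormalBasis ℝ Wᗮ
  let q : EucSp k → Fin m → ℝ := fun y i => b.repr (Wᗮ.orthogonalProjectionOnto (y - x)) i
  have hq : ∀ y i, |q y i| ≤ ‖y - x‖ := by
    intro y i
    calc |q y i| ≤ ‖b.repr (Wᗮ.orthogonalProjectionOnto (y - x))‖ :=
          PiLp.norm_apply_le (b.repr (Wᗮ.orthogonalProjectionOnto (y - x))) i
      _ = ‖Wᗮ.orthogonalProjectionOnto (y - x)‖ := b.repr.norm_map _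
      _ ≤ ‖y - x‖ := Wᗮ.norm_orthogonalProjectionOnto_apply_le _
  set C : ℝ := 1 + L * m with hC
  have hC0 : 0 ≤ C := by positivity
  have main : ∀ M : ℕ, 1 ≤ M → upperDensity n f A x ≤ ENNReal.ofReal ((3 * C) ^ n / M) := by
    intro M hM
    have hM0 : (0 : ℝ) < M := by exact_mod_cast hM
    refine limsup_le_of_le (by isBoundedDefault) ?_
    filter_upwards [small_ker hF hT hx W hW (η := 1 / M) (by positivity), self_mem_nhdsWithin]
      with r hr hr0
    replace hr0 : (0 : ℝ) < r := hr0
    let S : (Fin m → Finset.Icc (-(M : ℤ)) M) → Set LpInfty := fun c =>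
      F '' {y ∈ ball x r | ∀ i, ⌊q y i * M / r⌋ = c i}
    have hcov : f '' (ball x r ∩ A) ⊆ ⋃ c, S c := by
      rintro _ ⟨y, ⟨hyr, hyA⟩, rfl⟩
      have hy' : ‖y - x‖ < r := by simpa [dist_eq_norm] using hyr
      have hfl : ∀ i, ⌊q y i * M / r⌋ ∈ Finset.Icc (-(M : ℤ)) M := by
        intro i
        have h1 := abs_le.1 ((hq y i).trans hy'.le)
        rw [Finset.mem_Icc]
        constructor
        · rw [Int.le_floor, le_div_iff₀ hr0]
          push_cast
          nlinarith [h1.1]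
        · have : (⌊q y i * M / r⌋ : ℝ) ≤ M := by
            refine (Int.floor_le _).trans ?_
            rw [div_le_iff₀ hr0]
            nlinarith [h1.2]
          exact_mod_cast this
      refine mem_iUnion.2 ⟨fun i => ⟨_, hfl i⟩, y, ⟨hyr, fun i => rfl⟩, (hfF hyA).symm⟩
    have hdiam : ∀ c, Metric.ediam (S c) ≤ ENNReal.ofReal (C * r / M) := by
      intro c
      refine Metric.ediam_le ?_
      rintro _ ⟨y, ⟨hyr, hyc⟩, rfl⟩ _ ⟨z, ⟨hzr, hzc⟩, rfl⟩
      rw [edist_dist]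
      refine ENNReal.ofReal_le_ofReal ?_
      have hy' : ‖y - x‖ < r := by simpa [dist_eq_norm] using hyr
      have hz' : ‖z - x‖ < r := by simpa [dist_eq_norm] using hzr
      have hyz : ‖y - z‖ ≤ 2 * r := by
        have : y - z = (y - x) - (z - x) := by abel
        rw [this]
        exact (norm_sub_le _ _).trans (by linarith)
      set p := Wᗮ.orthogonalProjectionOnto (y - z) with hp
      set w := W.orthogonalProjectionOnto (y - z) with hw
      have hsum : (w : EucSp k) + p = y - z :=
        W.starProjection_add_starProjection_orthogonal (y - z)
      have hpc : ∀ i, |b.repr p i| ≤ r / M := by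
        intro i
        have e : b.repr p i = q y i - q z i := by
          have : y - z = (y - x) - (z - x) := by abel
          simp only [hp, q, this, map_sub]
          rfl
        rw [e]
        have h1 := Int.abs_sub_lt_one_of_floor_eq_floor ((hyc i).trans (hzc i).symm)
        rw [← sub_div, ← sub_mul, mul_div_assoc, abs_mul, abs_of_pos (div_pos hM0 hr0)] at h1
        have h2 : (M / r : ℝ) = (r / M)⁻¹ := by rw [inv_div]
        rw [h2, ← div_eq_mul_inv, div_lt_one (by positivity)] at h1
        exact h1.le
      have hpn : ‖(p : EucSp k)‖ ≤ m * (r / M) := by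
        have h1 : ‖p‖ ≤ ∑ i : Fin m, ‖b.repr p i • b i‖ := by
          conv_lhs => rw [← b.sum_repr p]
          exact norm_sum_le _ _
        refine (show ‖(p : EucSp k)‖ = ‖p‖ from rfl).trans_le (h1.trans ?_)
        calc _ ≤ ∑ i : Fin m, (r / M : ℝ) := by
              refine Finset.sum_le_sum fun i _ => ?_
              rw [norm_smul, b.norm_eq_one, mul_one]
              exact hpc i
          _ = _ := by simp
      have hwn : ‖(w : EucSp k)‖ ≤ 2 * r :=
        (W.norm_orthogonalProjectionOnto_apply_le (y - z)).trans hyz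
      have h1 := hr z hz'.le w w.2 hwn
      have hye : y = z + w + p := by rw [add_assoc, hsum]; abel
      have h2 : dist (F y) (F (z + w)) ≤ L * (m * (r / M)) := by
        refine (hF.dist_le_mul _ _).trans ?_
        gcongr
        rw [hye, dist_eq_norm, add_sub_cancel_left]
        exact hpn
      rw [← dist_eq_norm] at h1
      refine (dist_triangle _ _ _).trans ((add_le_add h2 h1).trans_eq ?_)
      rw [hC]
      field_simp
      ring
    refine ENNReal.div_le_of_le_mul ?_
    have hcont := hContent_le (n := n) (by omega) S hcov hdiam
    refine hcont.trans ?_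
    have hcard : Fintype.card (Fin m → Finset.Icc (-(M : ℤ)) M) = (2 * M + 1) ^ m := by
      rw [Fintype.card_fun, Fintype.card_coe, Int.card_Icc, Fintype.card_fin]
      congr 1
      omega
    rw [hcard]
    have hle : (((2 * M + 1) ^ m : ℕ) : ℝ≥0∞) * ENNReal.ofReal (C * r / M) ^ n ≤
        ENNReal.ofReal ((3 * C) ^ n / M) * ENNReal.ofReal r ^ n := by
      rw [← ENNReal.ofReal_natCast, ← ENNReal.ofReal_pow (by positivity),
        ← ENNReal.ofReal_pow hr0.le, ← ENNReal.ofReal_mul (by positivity),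
        ← ENNReal.ofReal_mul (by positivity)]
      refine ENNReal.ofReal_le_ofReal ?_
      push_cast
      exact real_bound hm hM hC0 hr0
    calc _ ≤ unitBallVol n * (ENNReal.ofReal ((3 * C) ^ n / M) * ENNReal.ofReal r ^ n) := by
          gcongr
          refine ENNReal.div_le_of_le_mul ?_
          exact le_mul_of_one_le_right (zero_le) (one_le_pow₀ (by norm_num))
      _ = _ := by ring
  have hlim : Tendsto (fun M : ℕ => ENNReal.ofReal ((3 * C) ^ n / M)) atTop (𝓝 0) := by
    rw [← ENNReal.ofReal_zero]
    exact ENNReal.tendsto_ofReal (tendsto_const_div_atTop_nhds_zero_nat _)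
  refine le_antisymm (ge_of_tendsto hlim ?_) (zero_le)
  filter_upwards [eventually_ge_atTop 1] with M hM using main M hM

lemma isDensityPoint_of_closedBall {k : ℕ} {A : Set (EucSp k)} {x : EucSp k}
    (h : Tendsto (fun r => volume (A ∩ closedBall x r) / volume (closedBall x r)) (𝓝[>] 0)
      (𝓝 1)) : IsDensityPoint A x := by
  refine h.congr' ?_
  filter_upwards [self_mem_nhdsWithin] with r hr
  have hr0 : r ≠ 0 := ne_of_gt hr
  have hae : (ball x r : Set (EucSp k)) =ᵐ[volume] closedBall x r := by
    have hs : volume (sphere x r) = 0 := Measure.addHaar_sphere_of_ne_zero _ x hr0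
    refine ball_subset_closedBall.eventuallyLE.antisymm ?_
    rw [ae_le_set, closedBall_sdiff_ball]
    exact hs
  rw [measure_congr hae, measure_congr ((ae_eq_refl A).inter hae)]

lemma compApprox {k : ℕ} {A : Set (EucSp k)} (hA : MeasurableSet A) {f F : EucSp k → LpInfty}
    (hfF : EqOn f F A) {x : EucSp k} (hxA : x ∈ A) (hd : IsDensityPoint A x)
    (hdiff : ∀ i : ℕ, DifferentiableAt ℝ (fun z => F z i) x) :
    HasCompApproxDerivWithinAt A f (compD F x) x := by
  intro i
  refine ⟨A, Subset.rfl, hA, hd, ?_⟩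
  have h := hasFDerivAt_iff_tendsto.1 (hdiff i).hasFDerivAt
  refine (h.mono_left nhdsWithin_le_nhds).congr' ?_
  filter_upwards [self_mem_nhdsWithin] with y hy
  simp only [hfF hy, hfF hxA, compD]
  rw [div_eq_inv_mul]
  rfl

theorem stmt7 {k n : ℕ} (hnk : n ≤ k)
    (A : Set (EucSp k)) (hA : MeasurableSet A)
    (f : EucSp k → LpInfty) (hf : ∃ L : ℝ≥0, LipschitzOnWith L f A)
    (hdens : 0 < volume {x ∈ A | 0 < upperDensity n f A x}) :
    0 < volume {x ∈ A | ∃ D : EucSp k →ₗ[ℝ] (ℕ → ℝ),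
      HasCompApproxDerivWithinAt A f D x ∧ (n : Cardinal) ≤ LinearMap.rank D} := by
  obtain ⟨L, hL⟩ := hf
  obtain ⟨F, hF, hfF⟩ := hL.extend_lp_infty
  obtain ⟨T, hTc, hTd⟩ := TopologicalSpace.exists_countable_dense (EucSp k)
  by_contra hcon
  have hN := nonpos_iff_eq_zero.1 (not_lt.1 hcon)
  refine hdens.ne' ?_
  have h1 : ∀ᵐ x ∂(volume : Measure (EucSp k)), ∀ i : ℕ, DifferentiableAt ℝ (fun z => F z i) x :=
    ae_all_iff.2 fun i => (lip_comp hF i).ae_differentiableAt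
  have h2 : ∀ᵐ x ∂(volume : Measure (EucSp k)), ∀ v ∈ T,
      Tendsto (fun ρ => ⨍ z in closedBall x ρ, gdir F v z) (𝓝[>] 0) (𝓝 (gdir F v x)) := by
    refine (ae_ball_iff hTc).2 fun v _ => ?_
    filter_upwards [IsUnifLocDoublingMeasure.ae_tendsto_average volume (gdir_locInt hF v) 1]
      with x hx
    refine hx (fun _ => x) (fun ρ => ρ) tendsto_id ?_
    filter_upwards [self_mem_nhdsWithin] with ρ hρ
    have : (0 : ℝ) < ρ := hρ
    simp [this.le]
  have h3 := (ae_restrict_iff' hA).1 (Besicovitch.ae_tendsto_measure_inter_div volume A)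
  have h4 := measure_eq_zero_iff_ae_notMem.1 hN
  rw [measure_eq_zero_iff_ae_notMem]
  filter_upwards [h1, h2, h3, h4] with x hx1 hx2 hx3 hx4 ⟨hxA, hxd⟩
  refine hxd.ne' (upperDensity_zero hF hTd hx2 ?_ hfF)
  by_contra hr
  refine hx4 ⟨hxA, compD F x,
    compApprox hA hfF hxA (isDensityPoint_of_closedBall (hx3 hxA)) hx1, ?_⟩
  rw [LinearMap.rank, ← Module.finrank_eq_rank]
  exact_mod_cast not_lt.1 hr

end
end

section
/- Fix 0 ≤ j < n ≤ k and an open set V ⊂ ℝ^k. Let f̂ : Â → ℓ^∞ be an L-Lipschitz map on a measurable set Â ⊂ V, let K̂ ⊂ Â be measurable with f̂_i(x) = x_i for i = 1,…,j and all x ∈ K̂ and rank(ap Df̂(x)) = j for all x ∈ K̂, and let y₀ ∈ ℝ^k. Then there is a constant C = C(k,n) > 0 such that: whenever M is a positive integer and d > 0 satisfies Q(y₀,d) ⊂ V and ℋ^k(Q(y₀,d) \ K̂) < (d/M)^k, the image f̂(Q(y₀,d) ∩ Â) can be covered by M^j balls of radius C·L·d·M⁻¹; in particular ℋ^n_∞(f̂(Q(y₀,d)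 ∩ Â)) ≤ ω_n (CLd)^n M^{j−n}. -/
open MeasureTheory Metric Set Filter
open scoped ENNReal NNReal Topology

noncomputable section

lemma aux_linear_zero {k : ℕ} (E : Set (EucSp k)) (x : EucSp k)
    (h : Tendsto (fun r => volume (E ∩ closedBall x r) / volume (closedBall x r)) (𝓝[>] 0) (𝓝 1))
    (ℓ : EucSp k →ₗ[ℝ] ℝ)
    (hl : ∀ ε > 0, ∀ᶠ y in 𝓝[E] x, |ℓ (y - x)| ≤ ε * ‖y - x‖) : ℓ = 0 := by
  by_contra hne
  obtain ⟨v, hv⟩ : ∃ v, 1 < ℓ v := by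
    obtain ⟨u, hu⟩ : ∃ u, ℓ u ≠ 0 := by
      by_contra! hc
      exact hne (LinearMap.ext hc)
    refine ⟨(2 / ℓ u) • u, ?_⟩
    rw [map_smul, smul_eq_mul, div_mul_cancel₀ _ hu]
    norm_num
  have hcont : Continuous ℓ := ℓ.continuous_of_finiteDimensional
  set t : Set (EucSp k) := {u | 1 < ℓ u} ∩ ball 0 (‖v‖ + 1) with ht
  have topen : IsOpen t := (isOpen_lt continuous_const hcont).inter isOpen_ball
  have tpos : volume t ≠ 0 := by
    refine (topen.measure_pos volume ⟨v, hv, ?_⟩).ne'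
    simp
  have hev := Measure.eventually_nonempty_inter_smul_of_density_one volume E x h t topen.measurableSet tpos
  set R := ‖v‖ + 1 with hR
  have hRpos : 0 < R := by positivity
  have h1 := hl (1 / R) (by positivity)
  rw [eventually_nhdsWithin_iff, Metric.eventually_nhds_iff] at h1
  obtain ⟨η, hη, h1⟩ := h1
  have hsmall : ∀ᶠ r in 𝓝[>] (0:ℝ), r < η / R :=
    mem_nhdsWithin_of_mem_nhds (Iio_mem_nhds (by positivity))
  obtain ⟨r, hr1, hr2, hr3⟩ := (hev.and (hsmall.and self_mem_nhdsWithin)).exists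
  obtain ⟨y, hyE, hy⟩ := hr1
  rw [Set.singleton_add, Set.mem_image] at hy
  obtain ⟨z, hz, rfl⟩ := hy
  rw [Set.mem_smul_set] at hz
  obtain ⟨u, hu, rfl⟩ := hz
  have hr0 : 0 < r := hr3
  have hun : ‖u‖ < R := by simpa using hu.2
  have hu1 : 1 < ℓ u := hu.1
  have hnorm : ‖r • u‖ = r * ‖u‖ := by rw [norm_smul, Real.norm_of_nonneg hr0.le]
  have := h1 (y := x + r • u) (by
    rw [dist_eq_norm, add_sub_cancel_left, hnorm]
    calc r * ‖u‖ ≤ r * R := by gcongr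
      _ < η := by rwa [← lt_div_iff₀ hRpos]) hyE
  rw [add_sub_cancel_left, hnorm, map_smul, smul_eq_mul, abs_of_pos (by positivity)] at this
  have h2 : 1 / R * (r * ‖u‖) ≤ r := by
    rw [one_div, inv_mul_le_iff₀ hRpos]; nlinarith
  nlinarith

lemma aux_density {k : ℕ} (hk : 0 < k) (E : Set (EucSp k)) (x : EucSp k)
    (h : IsDensityPoint E x) :
    Tendsto (fun r => volume (E ∩ closedBall x r) / volume (closedBall x r)) (𝓝[>] 0) (𝓝 1) := by
  have : Nonempty (Fin k) := ⟨⟨0, hk⟩⟩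
  have : Nontrivial (EucSp k) := inferInstance
  refine Tendsto.congr' ?_ h
  filter_upwards [self_mem_nhdsWithin] with r hr
  have hr0 : (0:ℝ) < r := hr
  have hae : (ball x r : Set (EucSp k)) =ᵐ[volume] closedBall x r := by
    refine ae_eq_of_subset_of_measure_ge ball_subset_closedBall ?_ measurableSet_ball.nullMeasurableSet
      measure_closedBall_lt_top.ne
    rw [Measure.addHaar_closedBall_eq_addHaar_ball]
  rw [measure_congr hae]
  congr 1
  exact measure_congr ((ae_eq_refl E).inter hae)

/-- The derivative of `g i` equals an approximate derivative of `f i`. -/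
lemma aux_deriv_eq {k : ℕ} (hk : 0 < k) (A : Set (EucSp k)) (f g : EucSp k → ℝ) (x : EucSp k)
    (hx : x ∈ A) (hfg : EqOn f g A) (D : EucSp k →ₗ[ℝ] ℝ) (hD : HasApproxDerivWithinAt A f D x)
    (hg : DifferentiableAt ℝ g x) : ∀ w, fderiv ℝ g x w = D w := by
  obtain ⟨Ax, hAx, -, hdens, hT⟩ := hD
  have key : D - (fderiv ℝ g x).toLinearMap = 0 := by
    apply aux_linear_zero Ax x (aux_density hk _ _ hdens)
    intro ε hε
    have h1 : ∀ᶠ y in 𝓝[Ax] x, |f y - f x - D (y - x)| / ‖y - x‖ < ε / 2 :=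
      hT.eventually (Iio_mem_nhds (by positivity))
    have h2 := (hg.hasFDerivAt.isLittleO).def (c := ε / 2) (by positivity)
    filter_upwards [h1, mem_nhdsWithin_of_mem_nhds h2, self_mem_nhdsWithin] with y h1 h2 h3
    rcases eq_or_ne y x with rfl | hne
    · simp
    have hp : 0 < ‖y - x‖ := norm_pos_iff.2 (sub_ne_zero.2 hne)
    rw [div_lt_iff₀ hp] at h1
    change ‖g y - g x - fderiv ℝ g x (y - x)‖ ≤ _ at h2
    rw [← hfg (hAx h3), ← hfg hx, Real.norm_eq_abs] at h2
    simp only [LinearMap.sub_apply, ContinuousLinearMap.coe_coe]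
    rw [abs_lt] at h1
    rw [abs_le] at h2 ⊢
    constructor <;> linarith [h1.1, h1.2, h2.1, h2.2]
  intro w
  have := LinearMap.congr_fun key w
  simp only [LinearMap.sub_apply, ContinuousLinearMap.coe_coe, LinearMap.zero_apply] at this
  linarith

/-- At a density point of `K` where `g` is a coordinate on `K`. -/
lemma aux_deriv_coord {k : ℕ} (K : Set (EucSp k)) (g : EucSp k → ℝ) (x : EucSp k)
    (hx : x ∈ K) (l : Fin k) (hgl : ∀ y ∈ K, g y = y l)
    (h : Tendsto (fun r => volume (K ∩ closedBall x r) / volume (closedBall x r)) (𝓝[>] 0) (𝓝 1))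
    (hg : DifferentiableAt ℝ g x) : ∀ w, fderiv ℝ g x w = w l := by
  have key : (EuclideanSpace.proj (𝕜 := ℝ) l : EucSp k →L[ℝ] ℝ).toLinearMap
      - (fderiv ℝ g x).toLinearMap = 0 := by
    apply aux_linear_zero K x h
    intro ε hε
    have h2 := (hg.hasFDerivAt.isLittleO).def (c := ε) (by positivity)
    filter_upwards [mem_nhdsWithin_of_mem_nhds h2, self_mem_nhdsWithin] with y h2 h3
    change ‖g y - g x - fderiv ℝ g x (y - x)‖ ≤ _ at h2
    rw [hgl y h3, hgl x hx, Real.norm_eq_abs] at h2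
    simpa using h2
  intro w
  have := LinearMap.congr_fun key w
  simp only [LinearMap.sub_apply, ContinuousLinearMap.coe_coe, LinearMap.zero_apply] at this
  have h3 : (EuclideanSpace.proj (𝕜 := ℝ) l : EucSp k →L[ℝ] ℝ) w = w l := rfl
  linarith

lemma aux_rank {k j : ℕ} (hjk : j ≤ k) (D : EucSp k →ₗ[ℝ] (ℕ → ℝ))
    (hD : LinearMap.rank D = (j : Cardinal))
    (hc : ∀ l : Fin k, (l : ℕ) < j → ∀ w, D w (l : ℕ) = w l)
    (w : EucSp k) (hw : ∀ l : Fin k, (l : ℕ) < j → w l = 0) : D w = 0 := by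
  let P : LinearMap.range D →ₗ[ℝ] (Fin j → ℝ) :=
    (LinearMap.pi fun l : Fin j => LinearMap.proj (l : ℕ)).comp (LinearMap.range D).subtype
  have hfr : Module.finrank ℝ (LinearMap.range D) = Module.finrank ℝ (Fin j → ℝ) := by
    rw [Module.finrank_fin_fun]
    exact Module.finrank_eq_of_rank_eq hD
  have hsurj : Function.Surjective P := by
    intro u
    refine ⟨⟨D (WithLp.toLp 2 fun l : Fin k => if h : (l : ℕ) < j then u ⟨l, h⟩ else 0), _, rfl⟩, ?_⟩
    ext l
    change D _ (l : ℕ) = u l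
    have := hc (Fin.castLE hjk l) (by simp) (WithLp.toLp 2 fun l : Fin k => if h : (l : ℕ) < j then u ⟨l, h⟩ else 0)
    simpa using this
  have hinj : Function.Injective P :=
    (LinearMap.injective_iff_surjective_of_finrank_eq_finrank hfr).2 hsurj
  have h0 : (⟨D w, w, rfl⟩ : LinearMap.range D) = 0 := by
    apply hinj
    rw [map_zero]
    ext l
    change D w (l : ℕ) = 0
    have := hc (Fin.castLE hjk l) (by simp) w
    rw [hw _ (by simp)] at this
    simpa using this
  exact congrArg Subtype.val h0

lemma aux_one_dim (h : ℝ → ℝ) (c : ℝ≥0) (hl : LipschitzWith c h) (B : Set ℝ)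
    (hB : MeasurableSet B) (hd : ∀ s ∈ Icc (0:ℝ) 1, s ∉ B → HasDerivAt h 0 s) (b : ℝ) (hb : 0 ≤ b)
    (hBv : volume (B ∩ Icc 0 1) ≤ ENNReal.ofReal b) : |h 1 - h 0| ≤ c * b := by
  have hac : AbsolutelyContinuousOnInterval h 0 1 :=
    (hl.lipschitzOnWith (s := uIcc 0 1)).absolutelyContinuousOnInterval
  rw [← hac.integral_deriv_eq_sub, intervalIntegral.integral_of_le zero_le_one]
  rw [← Real.norm_eq_abs]
  have hfin : volume (B ∩ Ioc (0:ℝ) 1) ≤ ENNReal.ofReal b :=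
    (measure_mono (inter_subset_inter_right _ Ioc_subset_Icc_self)).trans hBv
  calc ‖∫ x in Ioc (0:ℝ) 1, deriv h x‖ ≤ ∫ x in Ioc (0:ℝ) 1, B.indicator (fun _ => (c:ℝ)) x := by
        apply norm_integral_le_of_norm_le
        · exact (integrable_const _).indicator hB
        · filter_upwards [ae_restrict_mem measurableSet_Ioc] with x hx
          by_cases hxB : x ∈ B
          · rw [indicator_of_mem hxB]
            exact norm_deriv_le_of_lipschitz hl
          · rw [(hd x (Ioc_subset_Icc_self hx) hxB).deriv]
            simp [hxB]
    _ = c * (volume (B ∩ Ioc (0:ℝ) 1)).toReal := by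
        rw [integral_indicator hB, Measure.restrict_restrict hB]
        simp [Measure.real, mul_comm]
    _ ≤ c * b := by
        gcongr
        exact ENNReal.toReal_le_of_le_ofReal hb hfin

lemma aux_coord {k : ℕ} (g : EucSp k → LpInfty) (L : ℝ≥0) (hg : LipschitzWith L g) (i : ℕ) :
    LipschitzWith L (fun y => g y i) := by
  apply LipschitzWith.of_dist_le_mul
  intro a b
  refine le_trans ?_ (hg.dist_le_mul a b)
  rw [dist_eq_norm, dist_eq_norm]
  exact lp.norm_apply_le_norm (by simp) (g a - g b) i

lemma aux_norm_le {k : ℕ} (v : EucSp k) (b : ℝ) (hb : 0 ≤ b) (h : ∀ i, |v i| ≤ b) :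
    ‖v‖ ≤ k * b := by
  have h0 : ‖v‖ ^ 2 ≤ k * b ^ 2 := by
    rw [EuclideanSpace.norm_sq_eq]
    calc ∑ i, ‖v i‖ ^ 2 ≤ ∑ _i : Fin k, b ^ 2 := by
          apply Finset.sum_le_sum
          intro i _
          have := h i
          rw [Real.norm_eq_abs]
          gcongr
      _ = k * b ^ 2 := by simp
  have h1 : (k : ℝ) * b ^ 2 ≤ (k * b) ^ 2 := by
    rw [mul_pow]
    gcongr
    norm_cast
    exact Nat.le_self_pow (by norm_num) k
  exact abs_le_of_sq_le_sq' (h0.trans h1) (by positivity) |>.2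

def auxT (k : ℕ) (δ : ℝ) : Set (EucSp k) := {t | ∀ i, 0 ≤ t i ∧ t i ≤ δ}

lemma auxT_eq (k : ℕ) (δ : ℝ) :
    auxT k δ = (WithLp.ofLp : EucSp k → (Fin k → ℝ)) ⁻¹' (Icc (fun _ => 0) (fun _ => δ)) := by
  ext t
  simp [auxT, Pi.le_def, forall_and]

lemma auxT_meas (k : ℕ) (δ : ℝ) : MeasurableSet (auxT k δ) := by
  rw [auxT_eq]
  exact (PiLp.volume_preserving_ofLp (Fin k)).measurable measurableSet_Icc

lemma auxT_vol (k : ℕ) (δ : ℝ) (hδ : 0 ≤ δ) : volume (auxT k δ) = ENNReal.ofReal (δ ^ k) := by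
  rw [auxT_eq, (PiLp.volume_preserving_ofLp (Fin k)).measure_preimage
    measurableSet_Icc.nullMeasurableSet, Real.volume_Icc_pi, ENNReal.ofReal_pow hδ]
  simp

lemma aux_tube {k : ℕ} (B : Set (EucSp k)) (hB : MeasurableSet B) (δ : ℝ) (hδ : 0 < δ)
    (hBv : volume B ≤ ENNReal.ofReal (δ ^ k)) (p w : EucSp k) (m : Fin k) (hm : w m ≠ 0) :
    ∃ t ∈ auxT k δ, volume ({s : ℝ | p + t + s • w ∈ B} ∩ Icc 0 1) ≤
      ENNReal.ofReal (δ / |w m|) := by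
  set T := auxT k δ with hT
  have hTm : MeasurableSet T := auxT_meas k δ
  have hTv : volume T = ENNReal.ofReal (δ ^ k) := auxT_vol k δ hδ.le
  have hTpos : volume T ≠ 0 := by
    rw [hTv]
    simpa using pow_pos hδ k
  have hTtop : volume T ≠ ∞ := by rw [hTv]; exact ENNReal.ofReal_ne_top
  let F : EucSp k → ℝ → ℝ≥0∞ := fun t s => B.indicator 1 (p + t + s • w)
  have hF : Measurable (Function.uncurry F) := by
    apply (measurable_one.indicator hB).comp
    fun_prop
  have hFe : ∀ t, ∫⁻ s in Icc (0:ℝ) 1, F t s = volume ({s : ℝ | p + t + s • w ∈ B} ∩ Icc 0 1) := by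
    intro t
    have hms : MeasurableSet {s : ℝ | p + t + s • w ∈ B} := by
      have : Measurable fun s : ℝ => p + t + s • w := by fun_prop
      exact this hB
    rw [← Measure.restrict_apply hms, ← lintegral_indicator_one hms]
    rfl
  have hmain : ∫⁻ t in T, ∫⁻ s in Icc (0:ℝ) 1, F t s ≤
      ENNReal.ofReal (δ / |w m|) * volume T := by
    rw [lintegral_lintegral_swap hF.aemeasurable]
    have e1 : ∀ s : ℝ, ∫⁻ t in T, F t s =
        ∫⁻ z, B.indicator 1 z * T.indicator 1 (z - (p + s • w)) := by
      intro s
      rw [← lintegral_indicator hTm,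
        ← lintegral_sub_right_eq_self _ (p + s • w)]
      apply lintegral_congr
      intro z
      by_cases hz : z - (p + s • w) ∈ T
      · simp only [hz, indicator_of_mem, F]
        have : p + (z - (p + s • w)) + s • w = z := by abel
        rw [this]; simp
      · simp [hz]
    simp_rw [e1]
    rw [lintegral_lintegral_swap]
    · calc ∫⁻ z, ∫⁻ s in Icc (0:ℝ) 1, B.indicator 1 z * T.indicator 1 (z - (p + s • w))
          ≤ ∫⁻ z, B.indicator 1 z * ENNReal.ofReal (δ / |w m|) := by
            apply lintegral_mono
            intro z
            have hms : MeasurableSet {s : ℝ | z - (p + s • w) ∈ T} := by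
              have : Measurable fun s : ℝ => z - (p + s • w) := by fun_prop
              exact this hTm
            have hmf : Measurable fun s : ℝ => T.indicator (1 : EucSp k → ℝ≥0∞) (z - (p + s • w)) := by
              apply (measurable_one.indicator hTm).comp
              fun_prop
            simp only
            rw [lintegral_const_mul _ hmf]
            gcongr
            calc ∫⁻ s in Icc (0:ℝ) 1, T.indicator 1 (z - (p + s • w))
                ≤ ∫⁻ s, T.indicator 1 (z - (p + s • w)) := setLIntegral_le_lintegral _ _
              _ = volume {s : ℝ | z - (p + s • w) ∈ T} := by
                  rw [← lintegral_indicator_one hms]; rfl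
              _ ≤ volume (closedBall ((z m - p m - δ / 2) / w m) (δ / 2 / |w m|)) := by
                  apply measure_mono
                  intro s hs
                  have h1 := hs m
                  simp only [PiLp.sub_apply, PiLp.add_apply, PiLp.smul_apply, smul_eq_mul] at h1
                  rw [mem_closedBall, Real.dist_eq, le_div_iff₀ (abs_pos.2 hm), ← abs_mul,
                    sub_mul, div_mul_cancel₀ _ hm, abs_le]
                  constructor <;> linarith [h1.1, h1.2]
              _ = ENNReal.ofReal (δ / |w m|) := by
                  rw [Real.volume_closedBall]
                  congr 1
                  ring
        _ = volume B * ENNReal.ofReal (δ / |w m|) := by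
            rw [lintegral_mul_const _ (measurable_one.indicator hB), lintegral_indicator_one hB]
        _ ≤ ENNReal.ofReal (δ / |w m|) * volume T := by
            rw [mul_comm, hTv]
            gcongr
    · apply Measurable.aemeasurable
      apply Measurable.mul
      · exact (measurable_one.indicator hB).comp measurable_snd
      · apply (measurable_one.indicator hTm).comp
        fun_prop
  have hmeasF : Measurable fun t => ∫⁻ s in Icc (0:ℝ) 1, F t s := hF.lintegral_prod_right'
  obtain ⟨t, htT, ht⟩ := exists_le_setLAverage hTpos hTtop hmeasF.aemeasurable
  refine ⟨t, htT, ?_⟩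
  rw [← hFe]
  refine ht.trans ?_
  rw [setLAverage_eq]
  exact ENNReal.div_le_of_le_mul hmain

lemma aux_good {k j : ℕ} (hk : 0 < k) (hjk : j ≤ k) (A K : Set (EucSp k)) (hK : MeasurableSet K)
    (hKA : K ⊆ A) (f g : EucSp k → LpInfty) (L : ℝ≥0) (hg : LipschitzWith L g) (hfg : EqOn f g A)
    (hcoord : ∀ x ∈ K, ∀ i : Fin k, (i : ℕ) < j → f x (i : ℕ) = x i)
    (hrank : ∀ x ∈ K, ∃ D : EucSp k →ₗ[ℝ] (ℕ → ℝ),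
        HasCompApproxDerivWithinAt A f D x ∧ LinearMap.rank D = (j : Cardinal)) :
    ∀ᵐ z, z ∈ K → ∀ w : EucSp k, (∀ l : Fin k, (l : ℕ) < j → w l = 0) →
      ∀ i : ℕ, DifferentiableAt ℝ (fun y => g y i) z ∧ fderiv ℝ (fun y => g y i) z w = 0 := by
  have hgi : ∀ i : ℕ, LipschitzWith L (fun y => g y i) := by
    exact aux_coord g L hg
  have h1 : ∀ᵐ z : EucSp k, ∀ i : ℕ, DifferentiableAt ℝ (fun y => g y i) z :=
    ae_all_iff.2 fun i => (hgi i).ae_differentiableAt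
  have h2 := Besicovitch.ae_tendsto_measure_inter_div_of_measurableSet (volume : Measure (EucSp k)) hK
  filter_upwards [h1, h2] with z h1 h2 hz w hw i
  refine ⟨h1 i, ?_⟩
  rw [indicator_of_mem hz] at h2
  obtain ⟨D, hD, hDr⟩ := hrank z hz
  have hFD : ∀ i w, fderiv ℝ (fun y => g y i) z w = D w i := fun i w =>
    aux_deriv_eq hk A (fun y => f y i) (fun y => g y i) z (hKA hz)
      (fun y hy => by simp only [hfg hy]) _ (hD i) (h1 i) w
  have hc : ∀ l : Fin k, (l : ℕ) < j → ∀ w, D w (l : ℕ) = w l := by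
    intro l hl w
    rw [← hFD]
    apply aux_deriv_coord K _ z hz l _ h2 (h1 _)
    intro y hy
    rw [← hcoord y hy l hl, hfg (hKA hy)]
  rw [hFD, aux_rank hjk D hDr hc w hw]
  rfl

/-- The oscillation estimate. -/
lemma aux_osc {k j : ℕ} (Q K B : Set (EucSp k)) (g : EucSp k → LpInfty) (L : ℝ≥0)
    (hg : LipschitzWith L g) (hB : MeasurableSet B) (δ : ℝ) (hδ : 0 < δ)
    (hBv : volume B ≤ ENNReal.ofReal (δ ^ k))
    (hgood : ∀ z ∈ Q, z ∉ B → ∀ w : EucSp k, (∀ l : Fin k, (l : ℕ) < j → w l = 0) →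
      ∀ i : ℕ, DifferentiableAt ℝ (fun y => g y i) z ∧ fderiv ℝ (fun y => g y i) z w = 0)
    (hQc : Convex ℝ Q)
    (p q x y : EucSp k) (hp : ∀ t ∈ auxT k δ, p + t ∈ Q) (hq : ∀ t ∈ auxT k δ, q + t ∈ Q)
    (hpq : ∀ l : Fin k, (l : ℕ) < j → p l = q l) (hx : x - p ∈ auxT k δ) (hy : y - q ∈ auxT k δ) :
    ‖g x - g y‖ ≤ 3 * k * L * δ := by
  have hgd : ∀ a b, ‖g a - g b‖ ≤ L * ‖a - b‖ := fun a b => by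
    simpa [dist_eq_norm] using hg.dist_le_mul a b
  have hdiff : ∀ t ∈ auxT k δ, ∀ u ∈ auxT k δ, ‖t - u‖ ≤ k * δ := by
    intro t ht u hu
    apply aux_norm_le _ _ hδ.le
    intro i
    rw [PiLp.sub_apply, abs_le]
    constructor <;> linarith [(ht i).1, (ht i).2, (hu i).1, (hu i).2]
  have key : ∃ t ∈ auxT k δ, ‖g (q + t) - g (p + t)‖ ≤ k * L * δ := by
    by_cases hw : ∃ l, (q - p) l ≠ 0
    · obtain ⟨l0, hl0⟩ := hw
      obtain ⟨m, -, hm⟩ := Finset.exists_max_image Finset.univ (fun l => |(q - p) l|) ⟨l0, by simp⟩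
      have hmne : (q - p) m ≠ 0 := by
        have := hm l0 (by simp)
        have h3 := abs_pos.2 hl0
        exact abs_pos.1 (h3.trans_le this)
      have hmp := abs_pos.2 hmne
      have hnw : ‖q - p‖ ≤ k * |(q - p) m| := aux_norm_le _ _ (abs_nonneg _) fun i => hm i (by simp)
      obtain ⟨t, htT, ht⟩ := aux_tube B hB δ hδ hBv p (q - p) m hmne
      refine ⟨t, htT, ?_⟩
      apply lp.norm_le_of_forall_le (by positivity)
      intro i
      have hlip : LipschitzWith (L * ‖q - p‖₊) fun s : ℝ => g (p + t + s • (q - p)) i := by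
        refine (aux_coord g L hg i).comp ?_
        apply LipschitzWith.of_dist_le_mul
        intro a b
        rw [dist_add_left, dist_eq_norm, ← sub_smul, norm_smul, mul_comm, Real.dist_eq]
        rfl
      have hms : MeasurableSet {s : ℝ | p + t + s • (q - p) ∈ B} := by
        have : Measurable fun s : ℝ => p + t + s • (q - p) := by fun_prop
        exact this hB
      have := aux_one_dim _ _ hlip _ hms (fun s hs hsB => by
          have hzQ : p + t + s • (q - p) ∈ Q := by
            have := hQc (hp t htT) (hq t htT) (sub_nonneg.2 hs.2) hs.1 (by ring)
            convert this using 1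
            module
          obtain ⟨hd, h0⟩ := hgood _ hzQ hsB (q - p) (fun l hl => by simp [hpq l hl]) i
          have hder : HasDerivAt (fun s : ℝ => p + t + s • (q - p)) (q - p) s := by
            simpa using ((hasDerivAt_id s).smul_const (q - p)).const_add (p + t)
          have := hd.hasFDerivAt.comp_hasDerivAt s hder
          rw [h0] at this
          exact this) (δ / |(q - p) m|) (by positivity) ht
      have e1 : p + t + (1:ℝ) • (q - p) = q + t := by module
      have e0 : p + t + (0:ℝ) • (q - p) = p + t := by module
      rw [e1, e0] at this
      rw [lp.coeFn_sub, Pi.sub_apply, Real.norm_eq_abs]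
      refine this.trans ?_
      rw [NNReal.coe_mul, coe_nnnorm]
      calc (L : ℝ) * ‖q - p‖ * (δ / |(q - p) m|) ≤ L * (k * |(q - p) m|) * (δ / |(q - p) m|) := by
            gcongr
        _ = k * L * δ := by field_simp
    · push Not at hw
      have : q = p := by
        ext l
        have := hw l
        simp only [PiLp.sub_apply] at this
        linarith
      refine ⟨0, fun i => by simp [hδ.le], ?_⟩
      rw [this]
      simp
      positivity
  obtain ⟨t, htT, ht⟩ := key
  have h1 : ‖g x - g (p + t)‖ ≤ k * L * δ := by
    refine (hgd _ _).trans ?_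
    have := hdiff _ hx t htT
    rw [sub_sub] at this
    calc (L : ℝ) * ‖x - (p + t)‖ ≤ L * (k * δ) := by gcongr
      _ = _ := by ring
  have h2 : ‖g (q + t) - g y‖ ≤ k * L * δ := by
    refine (hgd _ _).trans ?_
    have := hdiff _ hy t htT
    rw [sub_sub, norm_sub_rev] at this
    calc (L : ℝ) * ‖(q + t) - y‖ ≤ L * (k * δ) := by gcongr
      _ = _ := by ring
  have e : g x - g y = (g x - g (p + t)) - (g (q + t) - g (p + t)) + (g (q + t) - g y) := by abel
  rw [e]
  refine (norm_add_le _ _).trans ?_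
  have := norm_sub_le (g x - g (p + t)) (g (q + t) - g (p + t))
  linarith

lemma aux_cover {k j : ℕ} (hk : 0 < k) (hjk : j ≤ k) (A K : Set (EucSp k)) (hK : MeasurableSet K)
    (hKA : K ⊆ A) (f : EucSp k → LpInfty) (L : ℝ≥0) (hf : LipschitzOnWith L f A)
    (hcoord : ∀ x ∈ K, ∀ i : Fin k, (i : ℕ) < j → f x (i : ℕ) = x i)
    (hrank : ∀ x ∈ K, ∃ D : EucSp k →ₗ[ℝ] (ℕ → ℝ),
        HasCompApproxDerivWithinAt A f D x ∧ LinearMap.rank D = (j : Cardinal))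
    (y₀ : EucSp k) (M : ℕ) (hM : 0 < M) (d : ℝ) (hd : 0 < d)
    (hvol : volume (closedCube y₀ d \ K) < ENNReal.ofReal ((d / M) ^ k)) :
    ∃ c : Fin (M ^ j) → LpInfty,
      f '' (closedCube y₀ d ∩ A) ⊆ ⋃ i, Metric.closedBall (c i) ((3 * k + 1) * L * d / M) := by
  obtain ⟨g, hg, hfg⟩ := hf.extend_lp_infty
  have hMr : (0:ℝ) < M := by exact_mod_cast hM
  have hM1 : (1:ℝ) ≤ M := by exact_mod_cast hM
  set δ := d / M with hδdef
  have hδ : 0 < δ := by positivity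
  have hMδ : M * δ = d := by rw [hδdef]; field_simp
  have hδd : δ ≤ d := by nlinarith
  have hgood := aux_good hk hjk A K hK hKA f g L hg hfg hcoord hrank
  rw [ae_iff] at hgood
  set N : Set (EucSp k) := {z | ¬ (z ∈ K → ∀ w : EucSp k, (∀ l : Fin k, (l : ℕ) < j → w l = 0) →
      ∀ i : ℕ, DifferentiableAt ℝ (fun y => g y i) z ∧ fderiv ℝ (fun y => g y i) z w = 0)} with hN
  set B := toMeasurable volume ((closedCube y₀ d \ K) ∪ N) with hBdef
  have hBv : volume B ≤ ENNReal.ofReal (δ ^ k) := by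
    rw [hBdef, measure_toMeasurable]
    refine (measure_union_le _ _).trans ?_
    rw [hgood, add_zero]
    exact hvol.le
  have hQc : Convex ℝ (closedCube y₀ d) := by
    intro a ha b hb s t hs ht hst i
    have h1 := ha i
    have h2 := hb i
    have : (s • a + t • b) i - y₀ i = s * (a i - y₀ i) + t * (b i - y₀ i) := by
      simp only [PiLp.add_apply, PiLp.smul_apply, smul_eq_mul]
      linear_combination (y₀ i) * hst
    rw [this]
    calc |s * (a i - y₀ i) + t * (b i - y₀ i)| ≤ s * |a i - y₀ i| + t * |b i - y₀ i| := by
          refine (abs_add_le _ _).trans ?_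
          rw [abs_mul, abs_mul, abs_of_nonneg hs, abs_of_nonneg ht]
      _ ≤ s * (d / 2) + t * (d / 2) := by gcongr
      _ = d / 2 := by rw [← add_mul, hst, one_mul]
  let q : (Fin j → Fin M) → EucSp k := fun ν => WithLp.toLp 2 fun l =>
    y₀ l - d / 2 + (if h : (l : ℕ) < j then ((ν ⟨l, h⟩ : ℕ) : ℝ) * δ else 0)
  refine ⟨fun i => g (q (finFunctionFinEquiv.symm i)), ?_⟩
  rintro _ ⟨x, ⟨hxQ, hxA⟩, rfl⟩
  -- index of the cell
  have hcell : ∀ l : Fin k, ∃ a : Fin M, y₀ l - d / 2 + (a : ℕ) * δ ≤ x l ∧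
      x l ≤ y₀ l - d / 2 + (a : ℕ) * δ + δ := by
    intro l
    have hxl := abs_le.1 (hxQ l)
    set u := x l - (y₀ l - d / 2) with hu
    have hu0 : 0 ≤ u / δ := div_nonneg (by linarith [hxl.1]) hδ.le
    have hfl := Nat.floor_le hu0
    have hfl2 := Nat.lt_floor_add_one (u / δ)
    rw [le_div_iff₀ hδ] at hfl
    rw [div_lt_iff₀ hδ] at hfl2
    by_cases hlt : ⌊u / δ⌋₊ < M
    · refine ⟨⟨_, hlt⟩, ?_, ?_⟩ <;> simp only <;> linarith
    · refine ⟨⟨M - 1, by omega⟩, ?_, ?_⟩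
      · have : ((M - 1 : ℕ) : ℝ) ≤ ⌊u / δ⌋₊ := by exact_mod_cast (by omega)
        simp only
        nlinarith
      · simp only
        rw [Nat.cast_sub hM]
        push_cast
        linarith [hxl.2]
  choose a ha1 ha2 using hcell
  let ν : Fin j → Fin M := fun l => a (Fin.castLE hjk l)
  let p : EucSp k := WithLp.toLp 2 fun l =>
    if (l : ℕ) < j then y₀ l - d / 2 + ((a l : ℕ) : ℝ) * δ else min (x l) (y₀ l + d / 2 - δ)
  have haM : ∀ l : Fin k, ∀ b : Fin M, ((b : ℕ) : ℝ) * δ ≤ d - δ := by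
    intro l b
    have : ((b : ℕ) : ℝ) + 1 ≤ M := by exact_mod_cast b.2
    nlinarith
  have hbox : ∀ r : EucSp k, (∀ l, y₀ l - d / 2 ≤ r l ∧ r l ≤ y₀ l + d / 2 - δ) →
      ∀ t ∈ auxT k δ, r + t ∈ closedCube y₀ d := by
    intro r hr t ht l
    rw [PiLp.add_apply, abs_le]
    constructor <;> linarith [(hr l).1, (hr l).2, (ht l).1, (ht l).2]
  have hqb : ∀ l, y₀ l - d / 2 ≤ q ν l ∧ q ν l ≤ y₀ l + d / 2 - δ := by
    intro l
    simp only [q]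
    split_ifs with h
    · have h1 := haM l (ν ⟨l, h⟩)
      constructor
      · have : 0 ≤ ((ν ⟨l, h⟩ : ℕ) : ℝ) * δ := by positivity
        linarith
      · linarith
    · constructor <;> linarith
  have hpb : ∀ l, y₀ l - d / 2 ≤ p l ∧ p l ≤ y₀ l + d / 2 - δ := by
    intro l
    simp only [p]
    have hxl := abs_le.1 (hxQ l)
    split_ifs with h
    · have h1 := haM l (a l)
      constructor
      · have : 0 ≤ ((a l : ℕ) : ℝ) * δ := by positivity
        linarith
      · linarith
    · exact ⟨le_min (by linarith) (by linarith), min_le_right _ _⟩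
  have hosc := aux_osc (j := j) (closedCube y₀ d) K B g L hg (measurableSet_toMeasurable _ _) δ hδ hBv
    (fun z hz hzB => by
      have hz2 : z ∉ (closedCube y₀ d \ K) ∪ N := fun h => hzB (subset_toMeasurable _ _ h)
      have hzK : z ∈ K := by
        by_contra hzK
        exact hz2 (Or.inl ⟨hz, hzK⟩)
      have hzN : z ∉ N := fun h => hz2 (Or.inr h)
      rw [hN, mem_ofPred_eq, not_not] at hzN
      exact hzN hzK)
    hQc p (q ν) x (q ν) (hbox p hpb) (hbox _ hqb)
    (fun l hl => by
      simp only [p, q, ν, hl, if_true, dif_pos]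
      rfl)
    (fun l => by
      rw [PiLp.sub_apply]
      simp only [p]
      have hxl := abs_le.1 (hxQ l)
      split_ifs with h
      · constructor <;> linarith [ha1 l, ha2 l]
      · constructor
        · linarith [min_le_left (x l) (y₀ l + d / 2 - δ)]
        · have : x l - δ ≤ min (x l) (y₀ l + d / 2 - δ) := le_min (by linarith) (by linarith)
          linarith)
    (fun l => by simp [hδ.le])
  refine mem_iUnion.2 ⟨finFunctionFinEquiv ν, ?_⟩
  simp only [Equiv.symm_apply_apply]
  rw [mem_closedBall, hfg hxA, dist_eq_norm]
  refine hosc.trans ?_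
  have hL : (0:ℝ) ≤ L := L.2
  have : (3 * (k:ℝ) + 1) * L * d / M = (3 * k + 1) * L * δ := by rw [hδdef]; ring
  rw [this]
  gcongr
  linarith

lemma aux_content (n j M : ℕ) (hM : 0 < M) (hjn : j < n) (E : Set LpInfty) (C : ℝ) (d : ℝ)
    (_hd : 0 ≤ d) (c : Fin (M ^ j) → LpInfty) (hC : 0 ≤ C * d)
    (hE : E ⊆ ⋃ i, Metric.closedBall (c i) (C * d / M)) :
    hContent n E ≤ unitBallVol n * ENNReal.ofReal (C * d) ^ n * (M : ℝ≥0∞) ^ ((j : ℤ) - (n : ℤ)) := by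
  have hMr : (0:ℝ) < M := by exact_mod_cast hM
  have hM0 : (M : ℝ≥0∞) ≠ 0 := by exact_mod_cast hM.ne'
  have hMt : (M : ℝ≥0∞) ≠ ∞ := ENNReal.natCast_ne_top M
  set u := unitBallVol n
  set R := ENNReal.ofReal (C * d) with hR
  let A : ℕ → Set LpInfty := fun i =>
    if h : i < M ^ j then Metric.closedBall (c ⟨i, h⟩) (C * d / M) else ∅
  have hcov : E ⊆ ⋃ i, A i := by
    intro x hx
    obtain ⟨i, hi⟩ := mem_iUnion.1 (hE hx)
    refine mem_iUnion.2 ⟨i, ?_⟩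
    simp only [A, i.2, dif_pos]
    exact hi
  have hn : n ≠ 0 := by omega
  have hdiam : ∀ i, Metric.ediam (A i) ≤ 2 * (R * (M : ℝ≥0∞)⁻¹) := by
    intro i
    simp only [A]
    split_ifs with h
    · apply Metric.ediam_le
      intro x hx y hy
      rw [edist_dist]
      have h1 : dist x y ≤ 2 * (C * d / M) := by
        rw [mem_closedBall] at hx hy
        have := dist_triangle_right x y (c ⟨i, h⟩)
        linarith
      refine (ENNReal.ofReal_le_ofReal h1).trans (le_of_eq ?_)
      rw [ENNReal.ofReal_mul (by norm_num), ENNReal.ofReal_div_of_pos hMr, hR, div_eq_mul_inv]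
      simp
    · simp
  have hsum : ∑' i, Metric.ediam (A i) ^ n ≤ (M : ℝ≥0∞) ^ j * (2 * (R * (M : ℝ≥0∞)⁻¹)) ^ n := by
    rw [tsum_eq_sum (s := Finset.range (M ^ j))]
    · calc ∑ i ∈ Finset.range (M ^ j), Metric.ediam (A i) ^ n
          ≤ ∑ _i ∈ Finset.range (M ^ j), (2 * (R * (M : ℝ≥0∞)⁻¹)) ^ n := by
            apply Finset.sum_le_sum
            intro i _
            gcongr
            exact hdiam i
        _ = _ := by simp
    · intro i hi
      have : ¬ i < M ^ j := by simpa using hi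
      simp [A, this, hn]
  have hle : hContent n E ≤ u / 2 ^ n * ∑' i, Metric.ediam (A i) ^ n :=
    iInf₂_le A hcov
  refine hle.trans ?_
  calc u / 2 ^ n * ∑' i, Metric.ediam (A i) ^ n
      ≤ u / 2 ^ n * ((M : ℝ≥0∞) ^ j * (2 * (R * (M : ℝ≥0∞)⁻¹)) ^ n) := by gcongr
    _ = u * R ^ n * ((M : ℝ≥0∞) ^ j * ((M : ℝ≥0∞)⁻¹) ^ n) * ((2 ^ n)⁻¹ * 2 ^ n) := by
        rw [div_eq_mul_inv, mul_pow, mul_pow]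
        ring
    _ = u * R ^ n * (M : ℝ≥0∞) ^ ((j : ℤ) - (n : ℤ)) := by
        rw [ENNReal.inv_mul_cancel (by simp) (by simp), mul_one, sub_eq_add_neg,
          ENNReal.zpow_add hM0 hMt, ENNReal.zpow_neg, zpow_natCast, zpow_natCast, ENNReal.inv_pow]
/-- Lemma HaMaLemma: for `j < n ≤ k` there is `C = C(k,n) > 0` such
that whenever `f̂ : Ahat → ℓ^∞` is `L`-Lipschitz, fixes the first `j` coordinates on
`Khat ⊆ Ahat` where its component-wise approximate derivative has rank `j`, and
`Q(y₀,d) ⊆ V` satisfies `ℋ^k(Q(y₀,d) \ Khat) < (d/M)^k`, then `f̂(Q(y₀,d) ∩ Ahat)` is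
covered by `M^j` balls of radius `CLd/M`; in particular
`ℋ^n_∞(f̂(Q(y₀,d) ∩ Ahat)) ≤ ω_n (CLd)^n M^{j-n}`. -/
theorem stmt9 (k n : ℕ) (hnk : n ≤ k) :
    ∃ C : ℝ, 0 < C ∧ ∀ (j : ℕ), j < n →
      ∀ (V : Set (EucSp k)), IsOpen V →
      ∀ (Ahat Khat : Set (EucSp k)), MeasurableSet Ahat → Ahat ⊆ V → MeasurableSet Khat → Khat ⊆ Ahat →
      ∀ (f : EucSp k → LpInfty) (L : ℝ≥0), LipschitzOnWith L f Ahat →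
      (∀ x ∈ Khat, ∀ i : Fin k, (i : ℕ) < j → f x (i : ℕ) = x i) →
      (∀ x ∈ Khat, ∃ D : EucSp k →ₗ[ℝ] (ℕ → ℝ),
        HasCompApproxDerivWithinAt Ahat f D x ∧ LinearMap.rank D = (j : Cardinal)) →
      ∀ (y₀ : EucSp k) (M : ℕ), 0 < M → ∀ d : ℝ, 0 < d → closedCube y₀ d ⊆ V →
      volume (closedCube y₀ d \ Khat) < ENNReal.ofReal ((d / M) ^ k) →
      ((∃ c : Fin (M ^ j) → LpInfty,
          f '' (closedCube y₀ d ∩ Ahat) ⊆ ⋃ i, Metric.closedBall (c i) (C * L * d / M)) ∧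
        hContent n (f '' (closedCube y₀ d ∩ Ahat)) ≤
          unitBallVol n * ENNReal.ofReal (C * L * d) ^ n * (M : ℝ≥0∞) ^ ((j : ℤ) - (n : ℤ))) := by

  refine ⟨3 * k + 1, by positivity, ?_⟩
  intro j hjn V hV A K hA hAV hK hKA f L hf hcoord hrank y₀ M hM d hd hQV hvol
  have hk : 0 < k := by omega
  obtain ⟨c, hc⟩ := aux_cover hk (by omega : j ≤ k) A K hK hKA f L hf hcoord hrank y₀ M hM d hd hvol
  exact ⟨⟨c, hc⟩, aux_content n j M hM hjn _ _ d hd.le c (by positivity) hc⟩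


end
end
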